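/- Let F be a field of characteristic different from two. An anisotropic form q over F of dimension at least two is a scalar multiple of a Pfister form (i.e. q ≅ a·π for some a ∈ F× and some Pfister form π) if and only if q becomes hyperbolic over its own function field F(q). -/

import Mathlib

set_option synthInstance.maxHeartbeats 1000000
set_option maxHeartbeats 4000000

open scoped BigOperators Classical

namespace QF

section Defs

variable {R : Type*} [CommRing R]

/-- Evaluation of the diagonal quadratic form with coefficients `d` at the vector `v`. -/
def evalQF {n : ℕ} (d : Fin n → R) (v : Fin n → R) : R := ∑ i, d i * v i ^ 2

/-- A form is isotropic if it represents zero non-trivially. -/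
def Isotropic {n : ℕ} (d : Fin n → R) : Prop := ∃ v : Fin n → R, v ≠ 0 ∧ evalQF d v = 0

def Anisotropic {n : ℕ} (d : Fin n → R) : Prop := ¬ Isotropic d

/-- Nondegeneracy of a diagonal form: all coefficients are nonzero. -/
def Nondeg {n : ℕ} (d : Fin n → R) : Prop := ∀ i, d i ≠ 0

/-- Two diagonal forms are isometric if a linear equivalence matches their values. -/
def Isometric {m n : ℕ} (d : Fin m → R) (e : Fin n → R) : Prop :=
  ∃ φ : (Fin m → R) ≃ₗ[R] (Fin n → R), ∀ v, evalQF e (φ v) = evalQF d v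

/-- Orthogonal sum of diagonal forms. -/
def osum {m n : ℕ} (d : Fin m → R) (e : Fin n → R) : Fin (m + n) → R := Fin.append d e

/-- Tensor product of diagonal forms. -/
def tensorQF {m n : ℕ} (d : Fin m → R) (e : Fin n → R) : Fin (m * n) → R :=
  fun i => d (finProdFinEquiv.symm i).1 * e (finProdFinEquiv.symm i).2

/-- Scaling of a form by a scalar. -/
def smulQF {n : ℕ} (a : R) (d : Fin n → R) : Fin n → R := fun i => a * d i

/-- `k` copies of the hyperbolic plane `⟨1,-1⟩`. -/
def hypform {R : Type*} [CommRing R] (k : ℕ) : Fin (k + k) → R :=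
  Fin.append (fun _ => 1) (fun _ => -1)

/-- A form is hyperbolic if it is isometric to a sum of hyperbolic planes,
i.e. its Witt index is half its dimension. -/
def IsHyperbolic {n : ℕ} (d : Fin n → R) : Prop := ∃ k : ℕ, Isometric d (hypform k)

/-- The Witt index: the largest `k` such that `d ≅ k×⟨1,-1⟩ ⊥ r`. -/
noncomputable def WittIndex {n : ℕ} (d : Fin n → R) : ℕ :=
  sSup {k : ℕ | ∃ (m : ℕ) (r : Fin m → R), Isometric d (osum (hypform k) r)}

/-- `r` is a subform of `d`: `d ≅ r ⊥ s` for some (nondegenerate) form `s`. -/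
def Subform {m n : ℕ} (r : Fin m → R) (d : Fin n → R) : Prop :=
  ∃ (k : ℕ) (s : Fin k → R), Nondeg s ∧ Isometric d (osum r s)

/-- The set of nonzero represented values. -/
def Dset {n : ℕ} (d : Fin n → R) : Set R :=
  {a | a ≠ 0 ∧ ∃ v : Fin n → R, evalQF d v = a}

/-- The group of similarity factors `G(q) = {a : a·q ≅ q}`. -/
def Gset {n : ℕ} (d : Fin n → R) : Set R :=
  {a | a ≠ 0 ∧ Isometric (smulQF a d) d}

/-- `H(q) = {a : ⟨1,-a⟩ ⊗ q is isotropic}`. -/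
def Hset {n : ℕ} (d : Fin n → R) : Set R :=
  {a | a ≠ 0 ∧ Isotropic (tensorQF ![1, -a] d)}

/-- Base change of a form along a ring homomorphism (e.g. a field extension). -/
def bc {S : Type*} [CommRing S] (f : R →+* S) {n : ℕ} (d : Fin n → R) : Fin n → S :=
  fun i => f (d i)

/-- The Pfister form `⟨1,a 0⟩ ⊗ ⋯ ⊗ ⟨1, a (n-1)⟩`: its `2^n` diagonal coefficients are
the products `∏_{j ∈ S} a j` over subsets `S` of the index set. -/
noncomputable def pfisterOf {n : ℕ} (a : Fin n → R) : Fin (2 ^ n) → R :=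
  fun i => ∏ j : Fin n, if (finFunctionFinEquiv.symm i) j = 0 then 1 else a j

/-- `π` is an `n`-fold Pfister form. -/
def IsNPfister (n : ℕ) {m : ℕ} (π : Fin m → R) : Prop :=
  ∃ a : Fin n → R, (∀ i, a i ≠ 0) ∧ Isometric π (pfisterOf a)

/-- `π` is a Pfister form. -/
def IsPfister {m : ℕ} (π : Fin m → R) : Prop := ∃ n : ℕ, IsNPfister n π

end Defs

/-- The quadric polynomial `p(X₁,…,Xₙ) = ∑ dᵢ Xᵢ²` attached to a diagonal form. -/
noncomputable def formPoly {F : Type*} [CommRing F] {n : ℕ} (d : Fin n → F) :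
    MvPolynomial (Fin n) F :=
  ∑ i, MvPolynomial.C (d i) * MvPolynomial.X i ^ 2

/-- The affine coordinate ring `F[X₁,…,Xₙ]/(p(X))` of the quadric `p = 0`. -/
abbrev CoordRing {F : Type*} [CommRing F] {n : ℕ} (d : Fin n → F) : Type _ :=
  MvPolynomial (Fin n) F ⧸ Ideal.span {formPoly d}

/-- The function field `F(p)` of the quadric `p = 0`: the total fraction ring of the
coordinate ring (the quotient field when the coordinate ring is a domain, i.e. when `p` is
anisotropic of dimension at least 2). -/
abbrev FunField {F : Type*} [Field F] {n : ℕ} (d : Fin n → F) : Type _ :=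
  FractionRing (CoordRing d)

end QF

namespace QF

section Polar

variable {ι : Type*} [Fintype ι] {R : Type*} [CommRing R]

/-- The diagonal quadratic form with coefficients `d`, over an arbitrary finite index type. -/
def qf (d v : ι → R) : R := ∑ i, d i * v i ^ 2

/-- The symmetric bilinear form with `bf d v v = qf d v`. -/
def bf (d : ι → R) : (ι → R) →ₗ[R] (ι → R) →ₗ[R] R :=
  LinearMap.mk₂ R (fun v w => ∑ i, d i * v i * w i)
    (fun x y z => by simp [mul_add, add_mul, Finset.sum_add_distrib])
    (fun c x y => by
      simp only [Pi.smul_apply, smul_eq_mul, Finset.mul_sum]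
      exact Finset.sum_congr rfl fun i _ => by ring)
    (fun x y z => by simp [mul_add, Finset.sum_add_distrib])
    (fun c x y => by
      simp only [Pi.smul_apply, smul_eq_mul, Finset.mul_sum]
      exact Finset.sum_congr rfl fun i _ => by ring)

theorem bf_apply (d v w : ι → R) : bf d v w = ∑ i, d i * v i * w i := rfl

theorem bf_self (d v : ι → R) : bf d v v = qf d v :=
  Finset.sum_congr rfl fun i _ => by ring

theorem bf_comm (d v w : ι → R) : bf d v w = bf d w v :=
  Finset.sum_congr rfl fun i _ => by ring

theorem qf_add (d v w : ι → R) : qf d (v + w) = qf d v + 2 * bf d v w + qf d w := by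
  simp only [← bf_self, map_add, LinearMap.add_apply, bf_comm d w v]
  ring

theorem qf_sub (d v w : ι → R) : qf d (v - w) = qf d v - 2 * bf d v w + qf d w := by
  simp only [← bf_self, map_sub, LinearMap.sub_apply, bf_comm d w v]
  ring

theorem qf_smul (d : ι → R) (c : R) (v : ι → R) : qf d (c • v) = c ^ 2 * qf d v := by
  simp only [← bf_self, map_smul, LinearMap.smul_apply, smul_eq_mul]
  ring

@[simp]
theorem qf_zero (d : ι → R) : qf d 0 = 0 := by simp [← bf_self]

theorem qf_single [DecidableEq ι] (d : ι → R) (i : ι) (c : R) :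
    qf d (Pi.single i c) = d i * c ^ 2 := by
  rw [qf, Finset.sum_eq_single i] <;> simp +contextual

theorem bf_single_single [DecidableEq ι] (d : ι → R) (i j : ι) :
    bf d (Pi.single i 1) (Pi.single j 1) = if i = j then d i else 0 := by
  rw [bf_apply, Finset.sum_eq_single i]
  · by_cases h : i = j <;> simp [h]
  · intro k _ hk
    simp [Pi.single_apply, hk]
  · simp

theorem map_bf {S : Type*} [CommRing S] (f : R →+* S) (d v w : ι → R) :
    f (bf d v w) = bf (fun i => f (d i)) (fun i => f (v i)) (fun i => f (w i)) := by
  simp [bf_apply]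

theorem map_qf {S : Type*} [CommRing S] (f : R →+* S) (d v : ι → R) :
    f (qf d v) = qf (fun i => f (d i)) (fun i => f (v i)) := by
  simp [qf]

/-- Anisotropy of a diagonal form over an arbitrary finite index type. -/
def Aniso (d : ι → R) : Prop := ∀ v, qf d v = 0 → v = 0

theorem qf_sum_of_orthogonal {κ : Type*} [Fintype κ] [DecidableEq κ] (d : ι → R) (c : κ → R)
    (e : κ → ι → R) (he : ∀ i j, bf d (e i) (e j) = if i = j then c i else 0) (y : κ → R) :
    qf d (∑ i, y i • e i) = qf c y := by
  simp only [← bf_self, map_sum, LinearMap.sum_apply, map_smul, LinearMap.smul_apply, he,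
    smul_eq_mul, bf_apply]
  simp only [mul_ite, mul_zero, Finset.mem_univ, if_true, Finset.sum_ite_eq']
  exact Finset.sum_congr rfl fun i _ => by ring

end Polar

section Field

variable {ι : Type*} [Fintype ι] {K : Type*} [Field K]

theorem bf_map_of_qf_map {κ : Type*} [Fintype κ] (h2 : (2 : K) ≠ 0) {d : ι → K} {e : κ → K} {p : K}
    {C : (ι → K) →ₗ[K] (κ → K)} (hC : ∀ y, qf e (C y) = p * qf d y) (x y : ι → K) :
    bf e (C x) (C y) = p * bf d x y := by
  have h := hC (x + y)
  rw [map_add, qf_add, qf_add, hC, hC] at h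
  apply mul_left_cancel₀ h2
  linear_combination h

/-- In an anisotropic space, vectors of equal length are exchanged by a reflection. -/
theorem exists_reflection {d : ι → K} (hd : Aniso d) (v w : ι → K)
    (h : qf d v = qf d w) :
    ∃ g : (ι → K) →ₗ[K] (ι → K), (∀ x y, bf d (g x) (g y) = bf d x y) ∧ g v = w ∧
      ∀ x, bf d x v = bf d x w → g x = x := by
  by_cases hu : v - w = 0
  · exact ⟨LinearMap.id, fun _ _ => rfl, sub_eq_zero.mp hu, fun _ _ => rfl⟩
  set u := v - w with hu'
  have hq : qf d u ≠ 0 := fun h0 => hu (hd u h0)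
  refine ⟨LinearMap.id - (LinearMap.toSpanSingleton K _ u).comp
    ((2 / qf d u) • (bf d u)), ?_, ?_, ?_⟩
  · intro x y
    simp only [LinearMap.sub_apply, LinearMap.id_apply, LinearMap.comp_apply,
      LinearMap.smul_apply, LinearMap.toSpanSingleton_apply, map_sub, map_smul, smul_eq_mul,
      bf_self, bf_comm d x u]
    field_simp
    ring
  · have h1 : 2 * bf d u v = qf d u := by
      rw [hu', qf_sub, h]
      simp only [map_sub, LinearMap.sub_apply, bf_self, h, bf_comm d w v]
      ring
    simp only [LinearMap.sub_apply, LinearMap.id_apply, LinearMap.comp_apply,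
      LinearMap.smul_apply, LinearMap.toSpanSingleton_apply, smul_eq_mul]
    rw [div_mul_eq_mul_div, h1, div_self hq, one_smul, hu']
    abel
  · intro x hx
    have h1 : bf d u x = 0 := by
      rw [bf_comm, hu', map_sub, hx, sub_self]
    simp [h1]

/-- Witt's extension theorem for finite families in an anisotropic space. -/
theorem exists_isometry_of_family {κ : Type*} {d : ι → K}
    (hd : Aniso d) (v w : κ → ι → K) (h : ∀ i j, bf d (v i) (v j) = bf d (w i) (w j))
    (s : Finset κ) :
    ∃ g : (ι → K) →ₗ[K] (ι → K), (∀ x y, bf d (g x) (g y) = bf d x y) ∧ ∀ i ∈ s, g (v i) = w i := by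
  induction s using Finset.induction_on with
  | empty => exact ⟨LinearMap.id, fun _ _ => rfl, by simp⟩
  | insert a s _ ih =>
    obtain ⟨g, hg, hgs⟩ := ih
    obtain ⟨r, hr, hra, hrx⟩ := exists_reflection hd (g (v a)) (w a) (by
      rw [← bf_self, ← bf_self, hg, h])
    refine ⟨r.comp g, fun x y => by simp [hr, hg], fun i hi => ?_⟩
    rcases Finset.mem_insert.mp hi with rfl | hi
    · exact hra
    · rw [LinearMap.comp_apply, hgs i hi]
      apply hrx
      rw [← h, ← hgs i hi, hg]

/-- `p` is a similarity factor of the form `d`. -/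
def Sim (d : ι → K) (p : K) : Prop :=
  ∃ C : (ι → K) →ₗ[K] (ι → K), ∀ y, qf d (C y) = p * qf d y

/-- Every value of the form is a similarity factor. -/
def Round (d : ι → K) : Prop := ∀ x, Sim d (qf d x)

theorem Round.double {κ : Type*} [Fintype κ] {c : ι → K} {c' : κ → K} (hc : Round c) (a : K)
    (Φ : (κ → K) ≃ₗ[K] (ι → K) × (ι → K))
    (hΦ : ∀ v, qf c' v = qf c (Φ v).1 + a * qf c (Φ v).2) : Round c' := by
  intro x
  rw [hΦ x]
  obtain ⟨Cu, hCu⟩ := hc (Φ x).1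
  obtain ⟨Cv, hCv⟩ := hc (Φ x).2
  set u := qf c (Φ x).1
  set v := qf c (Φ x).2
  suffices ∃ N : (ι → K) × (ι → K) →ₗ[K] (ι → K) × (ι → K), ∀ y,
      qf c (N y).1 + a * qf c (N y).2 = (u + a * v) * (qf c y.1 + a * qf c y.2) by
    obtain ⟨N, hN⟩ := this
    refine ⟨Φ.symm.toLinearMap ∘ₗ N ∘ₗ Φ.toLinearMap, fun y => ?_⟩
    simp [hΦ, hN]
  by_cases hu : u = 0
  · refine ⟨(a • (Cv ∘ₗ LinearMap.snd K _ _)).prod (Cv ∘ₗ LinearMap.fst K _ _), fun y => ?_⟩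
    simp only [LinearMap.prod_apply, Function.prod, LinearMap.smul_apply, LinearMap.comp_apply,
      LinearMap.fst_apply, LinearMap.snd_apply, qf_smul, hCv, hu]
    ring
  by_cases hv : v = 0
  · refine ⟨(Cu ∘ₗ LinearMap.fst K _ _).prod (Cu ∘ₗ LinearMap.snd K _ _), fun y => ?_⟩
    simp only [LinearMap.prod_apply, Function.prod, LinearMap.comp_apply,
      LinearMap.fst_apply, LinearMap.snd_apply, hCu, hv]
    ring
  let Z : (ι → K) × (ι → K) →ₗ[K] (ι → K) := (u * v)⁻¹ • (Cu ∘ₗ Cv ∘ₗ LinearMap.snd K _ _)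
  have hZ : ∀ y, u * v * qf c (Z y) = qf c y.2 := fun y => by
    simp only [Z, LinearMap.smul_apply, LinearMap.comp_apply, LinearMap.snd_apply, qf_smul, hCu,
      hCv]
    field_simp
  refine ⟨(Cu ∘ₗ (LinearMap.fst K _ _ - (a * v) • Z)).prod
    (Cv ∘ₗ (LinearMap.fst K _ _ + u • Z)), fun y => ?_⟩
  simp only [LinearMap.prod_apply, Function.prod, LinearMap.comp_apply, LinearMap.sub_apply,
    LinearMap.add_apply, LinearMap.smul_apply, LinearMap.fst_apply, hCu, hCv, qf_sub, qf_add,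
    qf_smul, map_smul, smul_eq_mul, ← hZ y]
  ring

end Field

section Pfister

/-- The coefficients of a Pfister form, indexed by the functions `Fin k → Fin 2`. -/
def pf {R : Type*} [CommRing R] {k : ℕ} (a : Fin k → R) (s : Fin k → Fin 2) : R :=
  ∏ j, if s j = 0 then 1 else a j

/-- The decomposition of a vector space with coordinates in `Fin (k + 1) → Fin 2` according to the
value at `0`. -/
def splitCons (K : Type*) [Field K] (k : ℕ) :
    ((Fin (k + 1) → Fin 2) → K) ≃ₗ[K] ((Fin k → Fin 2) → K) × ((Fin k → Fin 2) → K) where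
  toFun v := (fun s => v (Fin.cons 0 s), fun s => v (Fin.cons 1 s))
  invFun p s := if s 0 = 0 then p.1 (Fin.tail s) else p.2 (Fin.tail s)
  map_add' _ _ := rfl
  map_smul' _ _ := rfl
  left_inv v := by
    funext s
    by_cases h : s 0 = 0
    · simp only [h, if_true]
      rw [← h, Fin.cons_self_tail]
    · simp only [h, if_false]
      rw [← Fin.eq_one_of_ne_zero _ h, Fin.cons_self_tail]
  right_inv p := by ext s <;> simp

variable {K : Type*} [Field K]

theorem pf_cons_zero {R : Type*} [CommRing R] {k : ℕ} (a : Fin (k + 1) → R) (s : Fin k → Fin 2) :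
    pf a (Fin.cons 0 s) = pf (Fin.tail a) s := by
  simp [pf, Fin.prod_univ_succ, Fin.tail]

theorem pf_cons_one {R : Type*} [CommRing R] {k : ℕ} (a : Fin (k + 1) → R) (s : Fin k → Fin 2) :
    pf a (Fin.cons 1 s) = a 0 * pf (Fin.tail a) s := by
  simp [pf, Fin.prod_univ_succ, Fin.tail]

theorem qf_pf_split {k : ℕ} (a : Fin (k + 1) → K) (v : (Fin (k + 1) → Fin 2) → K) :
    qf (pf a) v = qf (pf (Fin.tail a)) (splitCons K k v).1 +
      a 0 * qf (pf (Fin.tail a)) (splitCons K k v).2 := by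
  rw [qf, ← (Fin.consEquiv fun _ => Fin 2).sum_comp, Fintype.sum_prod_type, Fin.sum_univ_two,
    qf, qf, Finset.mul_sum]
  refine congrArg₂ _ (Finset.sum_congr rfl fun i _ => ?_) (Finset.sum_congr rfl fun i _ => ?_)
  · exact congrArg (· * v (Fin.cons 0 i) ^ 2) (pf_cons_zero a i)
  · exact (congrArg (· * v (Fin.cons 1 i) ^ 2) (pf_cons_one a i)).trans (mul_assoc _ _ _)

theorem pf_ne_zero {k : ℕ} {a : Fin k → K} (ha : ∀ i, a i ≠ 0) (s : Fin k → Fin 2) :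
    pf a s ≠ 0 :=
  Finset.prod_ne_zero_iff.mpr fun j _ => by split_ifs <;> simp [ha]

/-- Pfister forms are round. -/
theorem round_pf {k : ℕ} (a : Fin k → K) : Round (pf a) := by
  induction k with
  | zero =>
    intro x
    refine ⟨x default • LinearMap.id, fun y => ?_⟩
    have h : qf (pf a) x = x default ^ 2 := by
      rw [qf, Fintype.sum_unique, pf, Fin.prod_univ_zero, one_mul]
      exact congrArg (x · ^ 2) (Subsingleton.elim _ _)
    rw [h, LinearMap.smul_apply, qf_smul, LinearMap.id_apply]
  | succ k ih => exact (ih (Fin.tail a)).double (a 0) (splitCons K k) (qf_pf_split a)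

/-- A quadratic map which is a sum of hyperbolic planes. -/
def Hyp {X : Type*} [AddCommGroup X] [Module K X] (Q : X → K) : Prop :=
  ∃ (k : ℕ) (Ψ : X ≃ₗ[K] (Fin k → K) × (Fin k → K)), ∀ x, Q x = ∑ i, (Ψ x).1 i * (Ψ x).2 i

theorem Hyp.of_fintype {X : Type*} [AddCommGroup X] [Module K X] {Q : X → K} {κ : Type*}
    [Fintype κ] (Ψ : X ≃ₗ[K] (κ → K) × (κ → K)) (h : ∀ x, Q x = ∑ i, (Ψ x).1 i * (Ψ x).2 i) :
    Hyp Q := by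
  let E := LinearEquiv.funCongrLeft K K (Fintype.equivFin κ).symm
  refine ⟨Fintype.card κ, Ψ.trans (E.prodCongr E), fun x => ?_⟩
  rw [h, ← (Fintype.equivFin κ).symm.sum_comp]
  rfl

theorem Hyp.comp {X Y : Type*} [AddCommGroup X] [Module K X] [AddCommGroup Y] [Module K Y]
    {Q : X → K} (hQ : Hyp Q) (Φ : Y ≃ₗ[K] X) : Hyp fun y => Q (Φ y) := by
  obtain ⟨k, Ψ, h⟩ := hQ
  exact ⟨k, Φ.trans Ψ, fun y => h (Φ y)⟩

theorem Hyp.smul {X : Type*} [AddCommGroup X] [Module K X] {Q : X → K} (hQ : Hyp Q) {a : K}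
    (ha : a ≠ 0) : Hyp fun x => a * Q x := by
  obtain ⟨k, Ψ, h⟩ := hQ
  refine ⟨k, Ψ.trans ((LinearEquiv.smulOfNeZero K _ a ha).prodCongr (LinearEquiv.refl K _)),
    fun x => ?_⟩
  simp only [h, Finset.mul_sum]
  exact Finset.sum_congr rfl fun i _ => mul_assoc _ _ _ |>.symm

theorem Hyp.prod {X Y : Type*} [AddCommGroup X] [Module K X] [AddCommGroup Y] [Module K Y]
    {Q : X → K} {Q' : Y → K} (hQ : Hyp Q) (hQ' : Hyp Q') :
    Hyp fun p : X × Y => Q p.1 + Q' p.2 := by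
  obtain ⟨k, Ψ, h⟩ := hQ
  obtain ⟨l, Ψ', h'⟩ := hQ'
  let E := LinearEquiv.sumArrowLequivProdArrow (Fin k) (Fin l) K K
  refine Hyp.of_fintype (κ := Fin k ⊕ Fin l)
    ((Ψ.prodCongr Ψ').trans ((LinearEquiv.prodProdProdComm K _ _ _ _).trans
      (E.symm.prodCongr E.symm))) fun p => ?_
  rw [h, h', Fintype.sum_sum_type]
  rfl

/-- The orthogonal sum of a form and its negative is hyperbolic. -/
theorem hyp_sub_self {ι : Type*} [Fintype ι] (h2 : (2 : K) ≠ 0) {c : ι → K} (hc : ∀ i, c i ≠ 0) :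
    Hyp fun p : (ι → K) × (ι → K) => qf c p.1 - qf c p.2 := by
  let D : (ι → K) →ₗ[K] (ι → K) := LinearMap.pi fun i => c i • LinearMap.proj i
  let N : (ι → K) × (ι → K) →ₗ[K] (ι → K) × (ι → K) :=
    (D ∘ₗ (LinearMap.fst K _ _ - LinearMap.snd K _ _)).prod
      (LinearMap.fst K _ _ + LinearMap.snd K _ _)
  have hN : Function.Injective N := by
    rw [← LinearMap.ker_eq_bot, LinearMap.ker_eq_bot']
    rintro ⟨y, z⟩ h
    have h1 : ∀ i, y i - z i = 0 := fun i => by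
      have := congrFun (congrArg Prod.fst h) i
      simpa [N, D, hc, ← mul_sub] using this
    have h3 : ∀ i, y i + z i = 0 := fun i => by
      simpa [N] using congrFun (congrArg Prod.snd h) i
    ext i
    · exact mul_left_cancel₀ h2 (show 2 * y i = 2 * 0 by linear_combination h1 i + h3 i)
    · exact mul_left_cancel₀ h2 (show 2 * z i = 2 * 0 by linear_combination h3 i - h1 i)
  refine Hyp.of_fintype (LinearEquiv.ofInjectiveEndo N hN) fun p => ?_
  rw [qf, qf, ← Finset.sum_sub_distrib]
  refine Finset.sum_congr rfl fun i _ => ?_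
  simp [N, D]
  ring

/-- An isotropic Pfister form is hyperbolic. -/
theorem hyp_pf_of_isotropic (h2 : (2 : K) ≠ 0) {k : ℕ} {a : Fin k → K} (ha : ∀ i, a i ≠ 0)
    (h : ¬ Aniso (pf a)) : Hyp (qf (pf a)) := by
  induction k with
  | zero =>
    refine absurd (fun v hv => ?_) h
    funext s
    rw [qf, Fintype.sum_unique] at hv
    rw [pf, Fin.prod_univ_zero, one_mul] at hv
    exact (congrArg v (Subsingleton.elim _ _)).trans (pow_eq_zero_iff two_ne_zero |>.mp hv)
  | succ k ih =>
    set c := pf (Fin.tail a) with hc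
    have ha' : ∀ i, Fin.tail a i ≠ 0 := fun i => ha i.succ
    suffices Hyp fun p : ((Fin k → Fin 2) → K) × ((Fin k → Fin 2) → K) =>
        qf c p.1 + a 0 * qf c p.2 by
      have h1 := this.comp (splitCons K k)
      rwa [← funext (qf_pf_split a)] at h1
    by_cases hcan : Aniso c
    · unfold Aniso at h
      push Not at h
      obtain ⟨x, hx, hx0⟩ := h
      rw [qf_pf_split, ← hc] at hx
      obtain ⟨Cu, hCu⟩ := round_pf (Fin.tail a) (splitCons K k x).1
      obtain ⟨Cv, hCv⟩ := round_pf (Fin.tail a) (splitCons K k x).2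
      rw [← hc] at hCu hCv
      set u := qf c (splitCons K k x).1 with hu
      set v := qf c (splitCons K k x).2 with hv
      have hv0 : v ≠ 0 := by
        intro h0
        rw [h0, mul_zero, add_zero] at hx
        have h1 := hcan _ (hu ▸ hx)
        have h2 := hcan _ (hv ▸ h0)
        exact hx0 ((splitCons K k).map_eq_zero_iff.mp (Prod.ext h1 h2))
      let C := v⁻¹ • (Cu ∘ₗ Cv)
      have hC : ∀ z, qf c (C z) = - (a 0 * qf c z) := fun z => by
        simp only [C, LinearMap.smul_apply, LinearMap.comp_apply, qf_smul, hCu, hCv]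
        rw [eq_neg_of_add_eq_zero_left hx]
        field_simp
      have hCinj : Function.Injective C := by
        rw [← LinearMap.ker_eq_bot, LinearMap.ker_eq_bot']
        intro z hz
        apply hcan
        have := hC z
        rw [hz, qf_zero] at this
        simpa [ha 0] using this
      have h1 := (hyp_sub_self h2 (pf_ne_zero ha')).comp
        ((LinearEquiv.refl K _).prodCongr (LinearEquiv.ofInjectiveEndo C hCinj))
      convert h1 using 2 with p
      have h3 : qf c (LinearEquiv.ofInjectiveEndo C hCinj p.2) = - (a 0 * qf c p.2) := hC p.2
      change _ = qf c p.1 - qf c (LinearEquiv.ofInjectiveEndo C hCinj p.2)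
      rw [h3, sub_neg_eq_add]
    · exact (ih ha' hcan).prod ((ih ha' hcan).smul (ha 0))

theorem Hyp.isHyperbolic (h2 : (2 : K) ≠ 0) {n : ℕ} {d : Fin n → K} (h : Hyp (qf d)) :
    IsHyperbolic d := by
  obtain ⟨k, Ψ, h⟩ := h
  let N : (Fin n → K) →ₗ[K] (Fin (k + k) → K) :=
    (LinearEquiv.funCongrLeft K K finSumFinEquiv.symm).toLinearMap ∘ₗ
    (LinearEquiv.sumArrowLequivProdArrow (Fin k) (Fin k) K K).symm.toLinearMap ∘ₗ
    LinearMap.prod ((2⁻¹ : K) • (LinearMap.fst K (Fin k → K) (Fin k → K) + LinearMap.snd K _ _))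
      ((2⁻¹ : K) • (LinearMap.fst K _ _ - LinearMap.snd K _ _)) ∘ₗ Ψ.toLinearMap
  have hN1 : ∀ v i, N v (Fin.castAdd k i) = 2⁻¹ * ((Ψ v).1 i + (Ψ v).2 i) := fun v i => by
    simp [N, LinearMap.funLeft, mul_add]
  have hN2 : ∀ v i, N v (Fin.natAdd k i) = 2⁻¹ * ((Ψ v).1 i - (Ψ v).2 i) := fun v i => by
    change (LinearEquiv.sumArrowLequivProdArrow (Fin k) (Fin k) K K).symm _
      (finSumFinEquiv.symm (Fin.natAdd k i)) = _
    rw [finSumFinEquiv_symm_apply_natAdd]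
    rfl
  have hinj : Function.Injective N := by
    rw [← LinearMap.ker_eq_bot, LinearMap.ker_eq_bot']
    intro v hv
    rw [← Ψ.map_eq_zero_iff]
    have h1 : ∀ i, (Ψ v).1 i + (Ψ v).2 i = 0 := fun i => by
      have := hN1 v i
      rw [hv] at this
      simpa [h2] using this.symm
    have h3 : ∀ i, (Ψ v).1 i - (Ψ v).2 i = 0 := fun i => by
      have := hN2 v i
      rw [hv] at this
      simpa [h2] using this.symm
    ext i
    · exact mul_left_cancel₀ h2 (show 2 * (Ψ v).1 i = 2 * 0 by linear_combination h1 i + h3 i)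
    · exact mul_left_cancel₀ h2 (show 2 * (Ψ v).2 i = 2 * 0 by linear_combination h1 i - h3 i)
  have hdim : Module.finrank K (Fin n → K) = Module.finrank K (Fin (k + k) → K) := by
    rw [Ψ.finrank_eq]
    simp
  refine ⟨k, LinearMap.linearEquivOfInjective N hinj hdim, fun v => ?_⟩
  change _ = qf d v
  rw [h, evalQF, Fin.sum_univ_add, ← Finset.sum_add_distrib]
  refine Finset.sum_congr rfl fun i _ => ?_
  rw [LinearMap.linearEquivOfInjective_apply, hN1, hN2]
  simp only [hypform, Fin.append_left, Fin.append_right]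
  field_simp
  ring

end Pfister

end QF

namespace QF

section Polynomial

open Polynomial

variable {ι : Type*} [Fintype ι] {K : Type*} [Field K] {d : ι → K}

theorem coeff_qf_of_natDegree_le (d : ι → K) {P : ι → K[X]} {m : ℕ}
    (hP : ∀ i, (P i).natDegree ≤ m) :
    (qf (fun i => C (d i)) P).coeff (2 * m) = qf d fun i => (P i).coeff m := by
  simp only [qf, finsetSum_coeff, coeff_C_mul]
  exact Finset.sum_congr rfl fun i _ => by rw [coeff_pow_of_natDegree_le (hP i)]

theorem natDegree_le_of_natDegree_qf_le (hd : Aniso d) {P : ι → K[X]} {m : ℕ}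
    (h : (qf (fun i => C (d i)) P).natDegree ≤ 2 * m) (i : ι) : (P i).natDegree ≤ m := by
  suffices ∀ k, (∀ i, (P i).natDegree ≤ m + k) → ∀ i, (P i).natDegree ≤ m from
    this (Finset.univ.sup fun i => (P i).natDegree)
      (fun i => le_add_left (Finset.le_sup (f := fun i => (P i).natDegree) (Finset.mem_univ i))) i
  intro k
  induction k with
  | zero => exact id
  | succ k ih =>
    intro hk
    refine ih fun i => ?_
    have h1 := coeff_qf_of_natDegree_le d hk
    rw [coeff_eq_zero_of_natDegree_lt (by omega)] at h1
    have h3 := congrFun (hd _ h1.symm) i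
    refine natDegree_le_iff_coeff_eq_zero.mpr fun j hj => ?_
    rcases (show m + k + 1 ≤ j by omega).eq_or_lt with rfl | hj'
    · exact h3
    · exact coeff_eq_zero_of_natDegree_lt ((hk i).trans_lt (by omega))

theorem Aniso.polynomial (hd : Aniso d) : Aniso fun i => (C (d i) : K[X]) := by
  intro P hP
  have h0 : ∀ i, (P i).natDegree ≤ 0 := natDegree_le_of_natDegree_qf_le hd (by simp [hP])
  have h1 := coeff_qf_of_natDegree_le d h0
  rw [hP, coeff_zero] at h1
  funext i
  rw [eq_C_of_natDegree_le_zero (h0 i), congrFun (hd _ h1.symm) i]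
  simp

/-- A common factor can be removed from a similitude over `K[X]` so that the denominator does not
vanish at `0`. -/
theorem exists_reduced {κ : Type*} (hd : Aniso d) {g : K[X]} (hg : g ≠ 0) (P : κ → ι → K[X])
    (c : κ → K[X]) (h : ∀ k, qf (fun i => C (d i)) (P k) = g ^ 2 * c k) :
    ∃ (m g₀ : K[X]) (P₀ : κ → ι → K[X]), m ≠ 0 ∧ g₀.eval 0 ≠ 0 ∧ g = m * g₀ ∧
      ∀ k i, P k i = m * P₀ k i := by
  induction hn : g.natDegree using Nat.strong_induction_on generalizing g P with
  | _ n ih =>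
  by_cases h0 : g.eval 0 = 0
  · obtain ⟨g', rfl⟩ := X_dvd_iff.mpr ((coeff_zero_eq_eval_zero g).trans h0)
    have hP : ∀ k i, X ∣ P k i := fun k i => by
      rw [X_dvd_iff, coeff_zero_eq_eval_zero]
      have h1 := congrArg (evalRingHom 0) (h k)
      rw [map_qf] at h1
      simp only [coe_evalRingHom, eval_C, eval_mul, eval_pow, eval_X, zero_mul, ne_eq,
        OfNat.ofNat_ne_zero, not_false_eq_true, zero_pow] at h1
      exact congrFun (hd _ h1) i
    choose P' hP' using hP
    have hg' : g' ≠ 0 := right_ne_zero_of_mul hg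
    obtain ⟨m, g₀, P₀, hm, h1, h3, h4⟩ := ih g'.natDegree
      (by rw [← hn, natDegree_X_mul hg']; omega) hg' P' (fun k => by
        have h1 : P k = (X : K[X]) • P' k := funext fun i => hP' k i
        have h3 := h k
        rw [h1, qf_smul] at h3
        apply mul_left_cancel₀ (pow_ne_zero 2 (X_ne_zero (R := K)))
        rw [h3]
        ring) rfl
    exact ⟨X * m, g₀, P₀, mul_ne_zero X_ne_zero hm, h1, by rw [h3, mul_assoc],
      fun k i => by rw [hP', h4, mul_assoc]⟩
  · exact ⟨1, g, P, one_ne_zero, h0, (one_mul g).symm, fun k i => (one_mul _).symm⟩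

/-- The Cassels–Pfister theorem, relative to a set of vectors to which the solution is
orthogonal. -/
theorem cassels_pfister (hd : Aniso d) (f : K[X]) (S : Set (ι → K)) {g : K[X]} (hg : g ≠ 0)
    {P : ι → K[X]} (h : qf (fun i => C (d i)) P = g ^ 2 * f)
    (hS : ∀ e ∈ S, bf (fun i => C (d i)) P (fun i => C (e i)) = 0) :
    ∃ Z : ι → K[X], qf (fun i => C (d i)) Z = f ∧
      ∀ e ∈ S, bf (fun i => C (d i)) Z (fun i => C (e i)) = 0 := by
  induction hn : g.natDegree using Nat.strong_induction_on generalizing g P with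
  | _ n ih =>
  set D : ι → K[X] := fun i => C (d i) with hD
  let T : ι → K[X] := fun i => P i / g
  let R : ι → K[X] := fun i => P i % g
  have hP : P = g • T + R := funext fun i => (EuclideanDomain.div_add_mod (P i) g).symm
  have hR : ∀ i, R i ∈ degreeLT K g.natDegree := fun i => by
    rw [mem_degreeLT, ← degree_eq_natDegree hg]
    exact EuclideanDomain.mod_lt _ hg
  have hT : ∀ e ∈ S, bf D T (fun i => C (e i)) = 0 := fun e he => by
    have h1 := hS e he
    rw [hP, map_add, map_smul, LinearMap.add_apply, LinearMap.smul_apply, smul_eq_mul] at h1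
    have h3 : bf D R (fun i => C (e i)) ∈ degreeLT K g.natDegree :=
      Submodule.sum_mem _ fun i _ => by
        rw [show D i * R i * C (e i) = (d i * e i) • R i by
          rw [smul_eq_C_mul, C_mul]; ring]
        exact Submodule.smul_mem _ _ (hR i)
    rw [mem_degreeLT, ← degree_eq_natDegree hg, eq_neg_of_add_eq_zero_right h1, degree_neg] at h3
    by_contra h0
    exact h3.not_ge (degree_le_mul_left _ h0)
  by_cases hR0 : R = 0
  · refine ⟨T, ?_, hT⟩
    rw [hP, hR0, add_zero, qf_smul] at h
    exact mul_left_cancel₀ (pow_ne_zero 2 hg) h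
  have hqR : qf D R ≠ 0 := fun h0 => hR0 (hd.polynomial R h0)
  have hRS : ∀ e ∈ S, bf D R (fun i => C (e i)) = 0 := fun e he => by
    have h1 := hS e he
    rwa [hP, map_add, map_smul, LinearMap.add_apply, LinearMap.smul_apply, hT e he, smul_zero,
      zero_add] at h1
  set s := qf D T
  set B := bf D T R
  set k := g * f - g * s - 2 * B with hk
  have hgk : qf D R = g * k := by
    rw [hP, qf_add, qf_smul, map_smul, LinearMap.smul_apply, smul_eq_mul] at h
    linear_combination h
  have hk0 : k ≠ 0 := fun h0 => hqR (by rw [hgk, h0, mul_zero])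
  have hdeg : k.natDegree < n := by
    obtain ⟨i, hi⟩ := Function.ne_iff.mp hR0
    have hRd : ∀ i, (R i).natDegree ≤ n - 1 := fun i => by
      by_cases h0 : R i = 0
      · simp [h0]
      · have := hR i
        rw [mem_degreeLT, ← natDegree_lt_iff_degree_lt h0] at this
        omega
    have hn0 : 0 < n := by
      have := hR i
      rw [mem_degreeLT, ← natDegree_lt_iff_degree_lt hi] at this
      omega
    have h1 : (qf D R).natDegree ≤ 2 * (n - 1) :=
      natDegree_sum_le_of_forall_le _ _ fun i _ =>
        (natDegree_C_mul_le _ _).trans (natDegree_pow_le_of_le 2 (hRd i))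
    rw [hgk, natDegree_mul hg hk0] at h1
    omega
  refine ih k.natDegree hdeg hk0 (P := k • T + (s - f) • R) ?_ (fun e he => ?_) rfl
  · rw [qf_add, qf_smul, qf_smul, hgk, map_smul, map_smul, LinearMap.smul_apply, smul_eq_mul,
      smul_eq_mul]
    change k ^ 2 * s + 2 * ((s - f) * (k * B)) + _ = _
    rw [hk]
    ring
  · simp [hT e he, hRS e he]

end Polynomial

section Specialization

open MvPolynomial

/-- A point of affine space can be moved along a polynomial path off a given hypersurface. -/
theorem exists_path {σ F K : Type*} [Field F] [Field K] [Algebra F K] {g : MvPolynomial σ F}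
    (hg : g ≠ 0) (x : σ → K) :
    ∃ w : σ → Polynomial K, (∀ i, (w i).eval 0 = x i) ∧ aeval w g ≠ 0 := by
  by_contra! h
  apply hg
  apply MvPolynomial.map_injective _ (algebraMap F (Polynomial K)).injective
  rw [map_zero]
  refine funext_set (fun i => {p : Polynomial K | p.eval 0 = x i}) (fun i => ?_) fun w hw => ?_
  · refine Set.infinite_of_injective_forall_mem (α := ℕ)
      (f := fun n => Polynomial.C (x i) + Polynomial.X ^ (n + 1)) (fun m n hmn => ?_) fun n => ?_
    · simpa using congrArg Polynomial.natDegree (add_left_cancel hmn)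
    · simp
  · rw [map_zero, eval_map, ← aeval_def]
    exact h w fun i => hw i (Set.mem_univ i)

theorem exists_path_hom {σ F K : Type*} [Field F] [Field K] [Algebra F K] {g : MvPolynomial σ F}
    (hg : g ≠ 0) (x : σ → K) :
    ∃ φ : MvPolynomial σ F →+* Polynomial K, (∀ a, φ (C a) = Polynomial.C (algebraMap F K a)) ∧
      (∀ p, (φ p).eval 0 = aeval x p) ∧ φ g ≠ 0 := by
  obtain ⟨w, hw, hwg⟩ := exists_path hg x
  refine ⟨(aeval w : _ →ₐ[F] Polynomial K).toRingHom, fun a => algHom_C _ a, fun p => ?_, hwg⟩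
  have : ((Polynomial.aeval (0 : K)).restrictScalars F).comp (aeval w) = aeval x := by
    ext i
    simp [hw]
  rw [← this]
  exact (congrFun (Polynomial.coe_aeval_eq_eval (0 : K)) _).symm

variable {ι : Type*} [Fintype ι] {F : Type*} [Field F] {d : ι → F}

theorem Aniso.mvPolynomial (σ : Type*) (hd : Aniso d) :
    Aniso fun i => (C (d i) : MvPolynomial σ F) := by
  intro P hP
  by_contra h
  obtain ⟨i, hi⟩ := Function.ne_iff.mp h
  obtain ⟨φ, hφ, -, hφi⟩ := exists_path_hom (K := F) hi 0
  apply hφi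
  have h1 := congrArg φ hP
  rw [map_qf, map_zero] at h1
  simp only [hφ, Algebra.algebraMap_self, RingHom.id_apply] at h1
  exact congrFun (hd.polynomial _ h1) i

theorem exists_common_denominator {R K : Type*} [CommRing R] [IsDomain R] [Field K] [Algebra R K]
    [IsFractionRing R K] (v : ι → K) :
    ∃ g : R, g ≠ 0 ∧ ∃ P : ι → R, ∀ i, algebraMap R K (P i) = algebraMap R K g * v i := by
  obtain ⟨g, hg⟩ := IsLocalization.exist_integer_multiples_of_finite (nonZeroDivisors R) v
  choose P hP using hg
  exact ⟨g, nonZeroDivisors.coe_ne_zero g, P, fun i => by rw [hP, Algebra.smul_def]⟩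

theorem Aniso.fractionRing {R : Type*} [CommRing R] [IsDomain R] {d : ι → R} (hd : Aniso d)
    (K : Type*) [Field K] [Algebra R K] [IsFractionRing R K] :
    Aniso fun i => algebraMap R K (d i) := by
  intro v hv
  obtain ⟨g, hg, P, hP⟩ := exists_common_denominator (R := R) v
  have hg' : algebraMap R K g ≠ 0 := by simpa using hg
  have h1 : P = 0 := by
    apply hd
    apply IsFractionRing.injective R K
    rw [map_qf, map_zero, funext hP]
    have h3 := qf_smul (fun i => algebraMap R K (d i)) (algebraMap R K g) v
    rw [hv, mul_zero] at h3
    exact h3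
  funext i
  have h3 := hP i
  rw [h1] at h3
  simpa [hg] using h3.symm

/-- Clearing the denominators of a vector over a rational function field. -/
theorem exists_polynomial_vector {σ : Type*} {v : ι → FractionRing (MvPolynomial σ F)}
    {p : MvPolynomial σ F}
    (hv : qf (fun i => algebraMap F (FractionRing (MvPolynomial σ F)) (d i)) v =
      algebraMap _ _ p) :
    ∃ g : MvPolynomial σ F, g ≠ 0 ∧ ∃ P : ι → MvPolynomial σ F,
      qf (fun i => C (d i)) P = g ^ 2 * p ∧
      ∀ e : ι → F, bf (fun i => algebraMap F (FractionRing (MvPolynomial σ F)) (d i)) v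
        (fun i => algebraMap F _ (e i)) = 0 →
          bf (fun i => C (d i)) P (fun i => C (e i)) = 0 := by
  let K := FractionRing (MvPolynomial σ F)
  obtain ⟨g, hg, P, hP⟩ := exists_common_denominator (R := MvPolynomial σ F) v
  have hP' : (fun i => algebraMap (MvPolynomial σ F) K (P i)) = algebraMap _ K g • v := funext hP
  refine ⟨g, hg, P, IsFractionRing.injective (MvPolynomial σ F) K ?_, fun e he =>
    IsFractionRing.injective (MvPolynomial σ F) K ?_⟩
  · rw [map_qf, hP', qf_smul, map_mul, map_pow, ← hv]
    rfl
  · rw [map_bf, hP', map_smul, LinearMap.smul_apply, map_zero]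
    exact (congrArg _ he).trans (smul_zero _)

/-- Specialization of a similitude with polynomial entries and a denominator. -/
theorem exists_specialization {K σ κ : Type*} [Field K] [Algebra F K]
    (hd : Aniso fun i => algebraMap F K (d i)) {g : MvPolynomial σ F} (hg : g ≠ 0)
    (P : κ → ι → MvPolynomial σ F) (c : κ → κ → MvPolynomial σ F)
    (hP : ∀ j k, bf (fun i => C (d i)) (P j) (P k) = g ^ 2 * c j k) (x : σ → K) :
    ∃ A : κ → ι → K,
      (∀ j k, bf (fun i => algebraMap F K (d i)) (A j) (A k) = aeval x (c j k)) ∧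
      ∀ j (e : ι → F), bf (fun i => C (d i)) (P j) (fun i => C (e i)) = 0 →
        bf (fun i => algebraMap F K (d i)) (A j) (fun i => algebraMap F K (e i)) = 0 := by
  obtain ⟨φ, hφC, hφ0, hφg⟩ := exists_path_hom hg x
  have hb : ∀ j k, bf (fun i => Polynomial.C (algebraMap F K (d i))) (fun i => φ (P j i))
      (fun i => φ (P k i)) = φ g ^ 2 * φ (c j k) := fun j k => by
    rw [← map_pow, ← map_mul, ← hP, map_bf]
    simp only [hφC]
  obtain ⟨m, g₀, P₀, hm, hg₀, hgm, hPm⟩ := exists_reduced hd (g := φ g) hφg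
    (fun j i => φ (P j i)) (fun j => φ (c j j)) fun j => by rw [← bf_self, hb]
  have hPm' : ∀ j, (fun i => φ (P j i)) = m • P₀ j := fun j => funext fun i => hPm j i
  refine ⟨fun j => (g₀.eval 0)⁻¹ • fun i => (P₀ j i).eval 0, fun j k => ?_, fun j e he => ?_⟩
  · have h1 := hb j k
    rw [hPm', hPm', hgm, map_smul, map_smul, LinearMap.smul_apply, smul_eq_mul, smul_eq_mul] at h1
    have h3 : bf (fun i => Polynomial.C (algebraMap F K (d i))) (P₀ j) (P₀ k) =
        g₀ ^ 2 * φ (c j k) := by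
      apply mul_left_cancel₀ (pow_ne_zero 2 hm)
      linear_combination h1
    have h4 := congrArg (Polynomial.evalRingHom 0) h3
    rw [map_bf] at h4
    simp only [Polynomial.coe_evalRingHom, Polynomial.eval_C, Polynomial.eval_mul,
      Polynomial.eval_pow, hφ0] at h4
    rw [map_smul, map_smul, LinearMap.smul_apply, smul_eq_mul, smul_eq_mul, h4]
    field_simp
  · have h1 := congrArg φ he
    rw [map_bf, map_zero, hPm', map_smul, LinearMap.smul_apply, smul_eq_mul] at h1
    have h3 := congrArg (Polynomial.evalRingHom 0) ((mul_eq_zero.mp h1).resolve_left hm)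
    rw [map_bf] at h3
    simp only [hφC, Polynomial.coe_evalRingHom, Polynomial.eval_C, Polynomial.eval_zero] at h3
    rw [map_smul, LinearMap.smul_apply, h3, smul_zero]

/-- The subform theorem: if an anisotropic form represents `∑ cᵢ Xᵢ²` over a rational function
field, with a vector orthogonal to a set `S` of constant vectors, then it represents the
diagonal form `c` in the orthogonal complement of `S`. -/
theorem exists_subform (h2 : (2 : F) ≠ 0) (hd : Aniso d) {N : ℕ} (c : Fin N → F)
    (S : Set (ι → F)) {g : MvPolynomial (Fin N) F} (hg : g ≠ 0) {P : ι → MvPolynomial (Fin N) F}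
    (hP : qf (fun i => C (d i)) P = g ^ 2 * qf (fun i => C (c i)) X)
    (hS : ∀ e ∈ S, bf (fun i => C (d i)) P (fun i => C (e i)) = 0) :
    ∃ f : Fin N → ι → F, (∀ i j, bf d (f i) (f j) = if i = j then c i else 0) ∧
      ∀ i, ∀ e ∈ S, bf d (f i) e = 0 := by
  induction N generalizing S with
  | zero => exact ⟨Fin.elim0, fun i => i.elim0, fun i => i.elim0⟩
  | succ N ih =>
    let R := MvPolynomial (Fin N) F
    let K := FractionRing R
    let φ : F →+* K := algebraMap F K
    have hφ : ∀ a, algebraMap R K (C a) = φ a := fun a => rfl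
    have hdK : Aniso fun i => φ (d i) := (hd.mvPolynomial (Fin N)).fractionRing K
    let θ : MvPolynomial (Fin (N + 1)) F →+* Polynomial K :=
      (Polynomial.mapRingHom (algebraMap R K)).comp (finSuccEquiv F N).toAlgHom.toRingHom
    have hθC : ∀ a, θ (C a) = Polynomial.C (φ a) := fun a => by
      simp [θ, finSuccEquiv_apply, hφ]
    have hθ0 : θ (X 0) = Polynomial.X := by simp [θ, finSuccEquiv_X_zero]
    have hθs : ∀ i : Fin N, θ (X i.succ) = Polynomial.C (algebraMap R K (X i)) := fun i => by
      simp [θ, finSuccEquiv_X_succ]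
    have hθg : θ g ≠ 0 := by
      intro h0
      apply hg
      apply (finSuccEquiv F N).injective
      apply Polynomial.map_injective _ (IsFractionRing.injective R K)
      simpa [θ] using h0
    set r : K := qf (fun i => φ (Fin.tail c i)) (fun i => algebraMap R K (X i)) with hr
    have hfr : θ (qf (fun i => C (c i)) X) =
        Polynomial.C (φ (c 0)) * Polynomial.X ^ 2 + Polynomial.C r := by
      rw [map_qf, qf, Fin.sum_univ_succ, hr, map_qf, qf]
      simp only [hθC, hθ0, hθs]
      rfl
    obtain ⟨Z, hZ, hZS⟩ := cassels_pfister hdK (θ (qf (fun i => C (c i)) X))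
      ((fun e i => φ (e i)) '' S) hθg (P := fun i => θ (P i))
      (by rw [← map_pow, ← map_mul, ← hP, map_qf]; simp only [hθC])
      (by
        rintro _ ⟨e, he, rfl⟩
        have h1 := congrArg θ (hS e he)
        rw [map_bf, map_zero] at h1
        simpa only [hθC] using h1)
    rw [hfr] at hZ
    have hZ1 : ∀ i, (Z i).natDegree ≤ 1 := natDegree_le_of_natDegree_qf_le hdK (by
      rw [hZ]
      compute_degree)
    let A : ι → K := fun i => (Z i).coeff 1
    let B : ι → K := fun i => (Z i).coeff 0
    have hZ0 : ∀ i, (Z i).eval 0 = B i := fun i => (Polynomial.coeff_zero_eq_eval_zero _).symm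
    have hZe : ∀ i, (Z i).eval 1 = (A + B) i := fun i => by
      rw [Polynomial.eq_X_add_C_of_natDegree_le_one (hZ1 i)]
      simp [A, B]
    have hqA : qf (fun i => φ (d i)) A = φ (c 0) := by
      rw [← coeff_qf_of_natDegree_le _ hZ1, hZ]
      simp
    have hqB : qf (fun i => φ (d i)) B = r := by
      have h1 := congrArg (Polynomial.evalRingHom 0) hZ
      rw [map_qf] at h1
      simpa [hZ0] using h1
    have hAB : bf (fun i => φ (d i)) A B = 0 := by
      have h1 := congrArg (Polynomial.evalRingHom 1) hZ
      rw [map_qf] at h1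
      simp only [Polynomial.coe_evalRingHom, Polynomial.eval_C, hZe] at h1
      change qf _ (A + B) = _ at h1
      rw [qf_add, hqA, hqB] at h1
      have h3 : (2 : K) ≠ 0 := by
        have := (map_ne_zero φ).mpr h2
        rwa [map_ofNat] at this
      apply mul_left_cancel₀ h3
      simp only [Polynomial.eval_add, Polynomial.eval_mul, Polynomial.eval_C, Polynomial.eval_pow,
        Polynomial.eval_X] at h1
      linear_combination h1
    have hBS : ∀ e ∈ S, bf (fun i => φ (d i)) B (fun i => φ (e i)) = 0 := fun e he => by
      have h1 := congrArg (Polynomial.evalRingHom 0) (hZS _ ⟨e, he, rfl⟩)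
      rw [map_bf] at h1
      simpa [hZ0] using h1
    have hAS : ∀ e ∈ S, bf (fun i => φ (d i)) A (fun i => φ (e i)) = 0 := fun e he => by
      have h1 := congrArg (Polynomial.evalRingHom 1) (hZS _ ⟨e, he, rfl⟩)
      rw [map_bf] at h1
      simp only [Polynomial.coe_evalRingHom, Polynomial.eval_C, hZe] at h1
      change bf _ (A + B) _ = _ at h1
      rw [map_add, LinearMap.add_apply, hBS e he, add_zero] at h1
      simpa using h1
    obtain ⟨g', hg', P', hP', hP'S⟩ :=
      exists_polynomial_vector (p := C (c 0)) hqA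
    obtain ⟨A₀, hA₀, hA₀S⟩ := exists_specialization (K := F) (κ := Unit) (d := d) hd hg'
      (fun _ => P') (fun _ _ => C (c 0)) (fun _ _ => by rw [bf_self, hP']) 0
    simp only [Algebra.algebraMap_self, RingHom.id_apply, algHom_C] at hA₀ hA₀S
    obtain ⟨ρ, hρ, hρA, hρS⟩ := exists_reflection hdK A (fun i => φ (A₀ () i)) (by
      rw [hqA, ← map_qf, ← bf_self, hA₀])
    have hρB : ∀ e ∈ insert (A₀ ()) S,
        bf (fun i => φ (d i)) (ρ B) (fun i => φ (e i)) = 0 := by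
      rintro e (rfl | he)
      · rw [← hρA, hρ, bf_comm, hAB]
      · rw [← hρS (fun i => φ (e i)), hρ, hBS e he]
        rw [bf_comm, hAS e he, bf_comm, ← map_bf, hA₀S () e (hP'S e (hAS e he)), map_zero]
    obtain ⟨g'', hg'', P'', hP'', hP''S⟩ :=
        exists_polynomial_vector (v := ρ B) (p := qf (fun i => C (Fin.tail c i)) X) (by
      rw [← bf_self, hρ, bf_self, hqB, hr, map_qf]
      rfl)
    obtain ⟨f, hf, hfS⟩ := ih (Fin.tail c) (insert (A₀ ()) S) hg'' hP''
      fun e he => hP''S e (hρB e he)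
    refine ⟨Fin.cons (A₀ ()) f, fun i j => ?_, fun i e he => ?_⟩
    · refine i.cases ?_ (fun i => ?_) <;> refine j.cases ?_ (fun j => ?_)
      · simpa using hA₀ () ()
      · simpa [Fin.succ_ne_zero, eq_comm, bf_comm] using hfS j _ (Set.mem_insert _ _)
      · simpa [Fin.succ_ne_zero] using hfS i _ (Set.mem_insert _ _)
      · simpa [Fin.tail] using hf i j
    · refine i.cases ?_ (fun i => ?_)
      · simpa using hA₀S () e (hP'S e (hAS e he))
      · simpa using hfS i e (Set.mem_insert_of_mem _ he)

end Specialization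

end QF

namespace QF

section Pfister

open MvPolynomial

universe u

variable {ι : Type*} [Fintype ι] {F : Type u} [Field F] {d : ι → F}

/-- The form is round over every extension field over which it is anisotropic. -/
def StronglyRound (d : ι → F) : Prop :=
  ∀ (K : Type u) [Field K] [Algebra F K], Aniso (fun i => algebraMap F K (d i)) →
    Round fun i => algebraMap F K (d i)

theorem bf_linearCombination {κ K : Type*} [Fintype κ] [DecidableEq κ] [Field K] (h2 : (2 : K) ≠ 0)
    {d : ι → K} {c : κ → K} {e : κ → ι → K}
    (he : ∀ i j, bf d (e i) (e j) = if i = j then c i else 0) (x y : κ → K) :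
    bf d (Fintype.linearCombination K e x) (Fintype.linearCombination K e y) = bf c x y := by
  rw [bf_map_of_qf_map h2 (p := 1) (d := c) fun y => ?_, one_mul]
  rw [Fintype.linearCombination_apply, qf_sum_of_orthogonal d c e he, one_mul]

theorem linearCombination_injective {κ K : Type*} [Fintype κ] [DecidableEq κ] [Field K]
    {d : ι → K} {c : κ → K} (hc : ∀ i, c i ≠ 0) {e : κ → ι → K}
    (he : ∀ i j, bf d (e i) (e j) = if i = j then c i else 0) :
    Function.Injective (Fintype.linearCombination K e) := by
  rw [← LinearMap.ker_eq_bot, LinearMap.ker_eq_bot']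
  intro y hy
  funext i
  have h1 : bf d (Fintype.linearCombination K e y) (e i) = y i * c i := by
    simp [Fintype.linearCombination_apply, he]
  rw [hy, map_zero, LinearMap.zero_apply] at h1
  exact (mul_eq_zero.mp h1.symm).resolve_right (hc i)

/-- If a strongly round anisotropic form contains a round form `c`, and a value `b` is represented
in its orthogonal complement, then the complement contains `b • c`. -/
theorem exists_orthogonal_scaled_copy (h2 : (2 : F) ≠ 0) (hd : Aniso d) (hr : StronglyRound d)
    {N : ℕ} {c : Fin N → F} (hc0 : ∀ i, c i ≠ 0)
    (hc : Round fun i => algebraMap F (FractionRing (MvPolynomial (Fin N) F)) (c i))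
    {e : Fin N → ι → F} (he : ∀ i j, bf d (e i) (e j) = if i = j then c i else 0)
    {y : ι → F} (hy : ∀ i, bf d (e i) y = 0) :
    ∃ f : Fin N → ι → F, (∀ i j, bf d (f i) (f j) = if i = j then qf d y * c i else 0) ∧
      ∀ i j, bf d (f i) (e j) = 0 := by
  let R := MvPolynomial (Fin N) F
  let K := FractionRing R
  let φ : F →+* K := algebraMap F K
  have h2K : (2 : K) ≠ 0 := by
    have := (map_ne_zero φ).mpr h2
    rwa [map_ofNat] at this
  have hdK : Aniso fun i => φ (d i) := (hd.mvPolynomial (Fin N)).fractionRing K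
  let eK : Fin N → ι → K := fun j i => φ (e j i)
  have heK : ∀ i j, bf (fun i => φ (d i)) (eK i) (eK j) = if i = j then φ (c i) else 0 :=
    fun i j => by
      rw [← map_bf, he]
      split_ifs <;> simp
  let t : Fin N → K := fun i => algebraMap R K (X i)
  let L := Fintype.linearCombination K eK
  have hL : ∀ x y, bf (fun i => φ (d i)) (L x) (L y) = bf (fun i => φ (c i)) x y :=
    bf_linearCombination h2K heK
  set p : K := qf (fun i => φ (c i)) t with hp
  have hp' : qf (fun i => φ (d i)) (L t) = p := by rw [← bf_self, hL, bf_self]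
  have ht : p = 0 → t = 0 := fun h0 => by
    apply linearCombination_injective (fun i => (map_ne_zero φ).mpr (hc0 i)) heK
    rw [map_zero]
    exact hdK _ (hp'.trans h0)
  obtain ⟨A, hA⟩ := hr K hdK (L t)
  obtain ⟨C', hC'⟩ := hc t
  change ∀ y, qf (fun i => φ (d i)) (A y) = qf (fun i => φ (d i)) (L t) * qf (fun i => φ (d i)) y
    at hA
  change ∀ y, qf (fun i => φ (c i)) (C' y) = p * qf (fun i => φ (c i)) y at hC'
  rw [hp'] at hA
  let v : Fin N → ι → K := fun i => A (L (p⁻¹ • C' (Pi.single i 1)))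
  have hv : ∀ i j, bf (fun i => φ (d i)) (v i) (v j) = bf (fun i => φ (d i)) (eK i) (eK j) := by
    intro i j
    have hp0 : p ≠ 0 := fun h0 => by
      have h1 := congrFun (ht h0) i
      exact X_ne_zero (R := F) i (IsFractionRing.injective R K (h1.trans (map_zero _).symm))
    rw [bf_map_of_qf_map h2K hA, hL, map_smul, map_smul, LinearMap.smul_apply,
      bf_map_of_qf_map h2K hC', heK, bf_single_single, smul_eq_mul, smul_eq_mul, ← mul_assoc, ← mul_assoc, ← mul_assoc]
    rw [mul_inv_cancel₀ hp0, one_mul, inv_mul_cancel₀ hp0, one_mul]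
  obtain ⟨ρ, hρ, hρv⟩ := exists_isometry_of_family hdK v eK hv Finset.univ
  let yK : ι → K := fun i => φ (y i)
  have hLy : ∀ x, bf (fun i => φ (d i)) (L x) yK = 0 := fun x => by
    rw [Fintype.linearCombination_apply, map_sum, LinearMap.sum_apply]
    refine Finset.sum_eq_zero fun i _ => ?_
    rw [map_smul, LinearMap.smul_apply, ← map_bf, hy, map_zero, smul_zero]
  have hz : ∀ i, bf (fun i => φ (d i)) (ρ (A yK)) (eK i) = 0 := fun i => by
    rw [bf_comm, ← hρv i (Finset.mem_univ i), hρ, bf_map_of_qf_map h2K hA, hLy, mul_zero]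
  have hqz : qf (fun i => φ (d i)) (ρ (A yK)) =
      algebraMap R K (qf (fun i => C (qf d y * c i)) X) := by
    rw [← bf_self, hρ, bf_self, hA, ← map_qf, hp]
    generalize qf d y = b
    rw [map_qf (algebraMap R K), qf, qf, Finset.sum_mul]
    refine Finset.sum_congr rfl fun i _ => ?_
    rw [C_mul, map_mul]
    change φ _ * _ * φ _ = φ _ * φ _ * _
    ring
  obtain ⟨g, hg, P, hP, hPe⟩ := exists_polynomial_vector hqz
  obtain ⟨f, hf, hfe⟩ := exists_subform h2 hd _ (Set.range e) hg hP (by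
    rintro _ ⟨i, rfl⟩
    exact hPe _ (hz i))
  exact ⟨f, hf, fun i j => hfe i _ ⟨j, rfl⟩⟩

theorem map_pf {R S : Type*} [CommRing R] [CommRing S] (φ : R →+* S) {k : ℕ} (a : Fin k → R)
    (s : Fin k → Fin 2) : φ (pf a s) = pf (fun i => φ (a i)) s := by
  simp only [pf, map_prod]
  exact Finset.prod_congr rfl fun j _ => by split_ifs <;> simp

theorem pfisterOf_apply {R : Type*} [CommRing R] {k : ℕ} (a : Fin k → R) (i : Fin (2 ^ k)) :
    pfisterOf a i = pf a (finFunctionFinEquiv.symm i) := rfl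

theorem qf_pfisterOf {R : Type*} [CommRing R] {k : ℕ} (a : Fin k → R) (v : Fin (2 ^ k) → R) :
    qf (pfisterOf a) v = qf (pf a) fun s => v (finFunctionFinEquiv s) := by
  rw [qf, ← finFunctionFinEquiv.sum_comp]
  simp [qf, pfisterOf_apply]

theorem round_pfisterOf {K : Type*} [Field K] {k : ℕ} (a : Fin k → K) : Round (pfisterOf a) := by
  intro x
  let E := LinearEquiv.funCongrLeft K K (finFunctionFinEquiv (m := 2) (n := k))
  have hE : ∀ v, qf (pf a) (E v) = qf (pfisterOf a) v := fun v => (qf_pfisterOf a v).symm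
  obtain ⟨C, hC⟩ := round_pf a (E x)
  refine ⟨E.symm.toLinearMap ∘ₗ C ∘ₗ E.toLinearMap, fun y => ?_⟩
  rw [← hE, ← hE, ← hE, ← hC]
  simp

/-- `d` contains the Pfister form defined by `a`. -/
def ContainsPfister (d : ι → F) {k : ℕ} (a : Fin k → F) : Prop :=
  ∃ e : (Fin k → Fin 2) → ι → F, ∀ s t, bf d (e s) (e t) = if s = t then pf a s else 0

theorem ContainsPfister.exists_cons (h2 : (2 : F) ≠ 0) (hd : Aniso d) (hr : StronglyRound d)
    {k : ℕ} {a : Fin k → F} (ha : ∀ i, a i ≠ 0) (h : ContainsPfister d a)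
    (hk : 2 ^ k < Fintype.card ι) : ∃ b, b ≠ 0 ∧ ContainsPfister d (Fin.cons b a : Fin (k + 1) → F) := by
  obtain ⟨e, he⟩ := h
  let M : (ι → F) →ₗ[F] ((Fin k → Fin 2) → F) := LinearMap.pi fun s => bf d (e s)
  obtain ⟨y, hyM, hy0⟩ := (Submodule.ne_bot_iff _).mp
    (M.ker_ne_bot_of_finrank_lt (by simpa using hk))
  have hy : ∀ s, bf d (e s) y = 0 := congrFun hyM
  refine ⟨qf d y, fun h0 => hy0 (hd y h0), ?_⟩
  let E := finFunctionFinEquiv (m := 2) (n := k)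
  obtain ⟨f, hf, hfe⟩ := exists_orthogonal_scaled_copy h2 hd hr (c := pfisterOf a)
    (fun i => pf_ne_zero ha _)
    (by simp only [pfisterOf_apply, map_pf]; exact round_pfisterOf _)
    (e := fun i => e (E.symm i)) (fun i j => by rw [he]; simp [pfisterOf_apply, E])
    (fun i => hy _)
  refine ⟨fun s => if s 0 = 0 then e (Fin.tail s) else f (E (Fin.tail s)), fun s t => ?_⟩
  have hfe' : ∀ s t, bf d (f s) (e t) = 0 := fun s t => by simpa using hfe s (E t)
  have hef : ∀ s t, bf d (e s) (f t) = 0 := fun s t => by rw [bf_comm, hfe']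
  obtain ⟨i, s, rfl⟩ : ∃ i s', s = Fin.cons i s' := ⟨s 0, Fin.tail s, (Fin.cons_self_tail s).symm⟩
  obtain ⟨j, t, rfl⟩ : ∃ i s', t = Fin.cons i s' := ⟨t 0, Fin.tail t, (Fin.cons_self_tail t).symm⟩
  fin_cases i <;> fin_cases j
  · have := pf_cons_zero (Fin.cons (qf d y) a : Fin (k + 1) → F) s
    rw [Fin.tail_cons] at this
    simp [he, this]
  · simp [hef]
  · simp [hfe']
  · have := pf_cons_one (Fin.cons (qf d y) a : Fin (k + 1) → F) s
    rw [Fin.tail_cons, Fin.cons_zero] at this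
    simp [hf, this, pfisterOf_apply, E]

/-- A strongly round anisotropic form representing `1` is a Pfister form. -/
theorem StronglyRound.exists_pfister (h2 : (2 : F) ≠ 0) {n : ℕ} {d : Fin n → F} (hd : Aniso d)
    (hr : StronglyRound d) {x : Fin n → F} (hx : qf d x = 1) :
    ∃ (k : ℕ) (a : Fin k → F), (∀ i, a i ≠ 0) ∧ Isometric d (pfisterOf a) := by
  have hinj : ∀ {k : ℕ} {a : Fin k → F}, (∀ i, a i ≠ 0) → ContainsPfister d a → ∃ (L :
      ((Fin k → Fin 2) → F) →ₗ[F] (Fin n → F)), Function.Injective L ∧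
        ∀ y, qf d (L y) = qf (pf a) y := by
    rintro k a ha ⟨e, he⟩
    exact ⟨Fintype.linearCombination F e, linearCombination_injective (pf_ne_zero ha) he,
      fun y => qf_sum_of_orthogonal d _ e he y⟩
  have hle : ∀ {k : ℕ} {a : Fin k → F}, (∀ i, a i ≠ 0) → ContainsPfister d a → 2 ^ k ≤ n := by
    intro k a ha h
    obtain ⟨L, hL, -⟩ := hinj ha h
    simpa using LinearMap.finrank_le_finrank_of_injective hL
  obtain ⟨k, a, ha, h, hk⟩ : ∃ (k : ℕ) (a : Fin k → F), (∀ i, a i ≠ 0) ∧ ContainsPfister d a ∧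
      2 ^ k = n := by
    by_contra! H
    have hall : ∀ k, ∃ a : Fin k → F, (∀ i, a i ≠ 0) ∧ ContainsPfister d a := by
      intro k
      induction k with
      | zero =>
        refine ⟨Fin.elim0, fun i => i.elim0, fun _ => x, fun s t => ?_⟩
        rw [bf_self, hx, if_pos (Subsingleton.elim _ _), pf, Fin.prod_univ_zero]
      | succ k ih =>
        obtain ⟨a, ha, h⟩ := ih
        obtain ⟨b, hb, hba⟩ := h.exists_cons h2 hd hr ha
          (by simpa using lt_of_le_of_ne (hle ha h) (H k a ha h))
        exact ⟨Fin.cons b a, fun i => i.cases hb ha, hba⟩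
    obtain ⟨a, ha, h⟩ := hall n
    exact (hle ha h).not_gt Nat.lt_two_pow_self
  obtain ⟨L, hL, hLq⟩ := hinj ha h
  let E := LinearEquiv.funCongrLeft F F (finFunctionFinEquiv (m := 2) (n := k))
  let M := E.trans (LinearMap.linearEquivOfInjective L hL (by simp [hk]))
  refine ⟨k, a, ha, M.symm, fun v => ?_⟩
  obtain ⟨w, rfl⟩ := M.surjective v
  rw [M.symm_apply_apply]
  exact (qf_pfisterOf a w).trans (hLq (E w)).symm

end Pfister

end QF

namespace QF

section FunctionField

open MvPolynomial

universe u

theorem dvd_of_aeval_omega_eq_zero {K : Type*} [Field K] {a : K} {p : Polynomial K}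
    (h : Polynomial.aeval (QuadraticAlgebra.omega : QuadraticAlgebra K a 0) p = 0) :
    Polynomial.X ^ 2 - Polynomial.C a ∣ p := by
  have hm : (Polynomial.X ^ 2 - Polynomial.C a).Monic := Polynomial.monic_X_pow_sub_C a two_ne_zero
  rw [← Polynomial.modByMonic_eq_zero_iff_dvd hm]
  have hroot : Polynomial.aeval (QuadraticAlgebra.omega : QuadraticAlgebra K a 0)
      (Polynomial.X ^ 2 - Polynomial.C a) = 0 := by
    simp only [map_sub, map_pow, Polynomial.aeval_X, Polynomial.aeval_C]
    rw [pow_two, QuadraticAlgebra.omega_mul_omega_eq_mk, QuadraticAlgebra.algebraMap_eq, sub_self]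
  have hdeg : (p %ₘ (Polynomial.X ^ 2 - Polynomial.C a)).natDegree ≤ 1 := by
    have := Polynomial.natDegree_modByMonic_lt p hm (by
      intro h1
      simpa using congrArg Polynomial.natDegree h1)
    rw [Polynomial.natDegree_X_pow_sub_C] at this
    omega
  rw [← Polynomial.modByMonic_add_div p (Polynomial.X ^ 2 - Polynomial.C a), map_add, map_mul,
    hroot, zero_mul, add_zero, Polynomial.eq_X_add_C_of_natDegree_le_one hdeg] at h
  rw [Polynomial.eq_X_add_C_of_natDegree_le_one hdeg]
  have h0 := congrArg QuadraticAlgebra.re h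
  have h1 := congrArg QuadraticAlgebra.im h
  simp at h0 h1
  simp [h0, h1]

variable {F : Type u} [Field F] {m : ℕ}

/-- The form in the last variables, as a polynomial. -/
noncomputable def tailPoly (q : Fin (m + 1) → F) : MvPolynomial (Fin m) F :=
  qf (fun i => C (q i.succ)) X

theorem finSuccEquiv_formPoly (q : Fin (m + 1) → F) :
    finSuccEquiv F m (formPoly q) =
      Polynomial.C (C (q 0)) * Polynomial.X ^ 2 + Polynomial.C (tailPoly q) := by
  simp [formPoly, tailPoly, qf, Fin.sum_univ_succ, finSuccEquiv_apply]

theorem Aniso.ne_zero {ι R : Type*} [Fintype ι] [CommRing R] [Nontrivial R] {d : ι → R}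
    (hd : Aniso d) (i : ι) : d i ≠ 0 := by
  intro h
  have h1 := hd (Pi.single i 1) (by rw [qf_single, h, zero_mul])
  simpa using congrFun h1 i

/-- The coordinate ring of an anisotropic quadric embeds into a quadratic extension of a rational
function field. -/
theorem exists_quadratic_hom {q : Fin (m + 1) → F} (hq : Aniso q) (hm : 0 < m) :
    ∃ a : FractionRing (MvPolynomial (Fin m) F),
      algebraMap F _ (q 0) * a = - algebraMap _ _ (tailPoly q) ∧ (∀ s, s ^ 2 ≠ a) ∧
      ∃ Θ : MvPolynomial (Fin (m + 1)) F →+* QuadraticAlgebra _ a 0,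
        RingHom.ker Θ = Ideal.span {formPoly q} ∧
        ∀ c, Θ (C c) =
          algebraMap (FractionRing (MvPolynomial (Fin m) F)) _ (algebraMap F _ c) := by
  let R := MvPolynomial (Fin m) F
  let K := FractionRing R
  let φ : F →+* K := algebraMap F K
  have hφ : ∀ a, algebraMap R K (C a) = φ a := fun a => rfl
  have hq0 : q 0 ≠ 0 := hq.ne_zero 0
  have hφq : φ (q 0) ≠ 0 := (map_ne_zero φ).mpr hq0
  let r : R := C (q 0)⁻¹ * tailPoly q
  have hr : C (q 0) * r = tailPoly q := by
    rw [← mul_assoc, ← C_mul, mul_inv_cancel₀ hq0, C_1, one_mul]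
  have hra : φ (q 0) * -algebraMap R K r = - algebraMap R K (tailPoly q) := by
    rw [mul_neg, ← hφ, ← map_mul, hr]
  let a : K := -algebraMap R K r
  refine ⟨a, hra, fun s hs => ?_, ?_⟩
  · have h1 : qf (fun i => φ (q i)) (Fin.cons s fun i => algebraMap R K (X i)) = 0 := by
      rw [qf, Fin.sum_univ_succ]
      simp only [Fin.cons_zero, Fin.cons_succ, hs]
      rw [hra, tailPoly, map_qf]
      exact neg_add_cancel _
    have h3 := congrFun ((hq.mvPolynomial (Fin m)).fractionRing K _ h1) (Fin.succ ⟨0, hm⟩)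
    rw [Fin.cons_succ] at h3
    exact X_ne_zero (R := F) _ (IsFractionRing.injective R K (h3.trans (map_zero _).symm))
  · let ψ : MvPolynomial (Fin (m + 1)) F →+* Polynomial K :=
      (Polynomial.mapRingHom (algebraMap R K)).comp (finSuccEquiv F m).toAlgHom.toRingHom
    let ev : Polynomial K →+* QuadraticAlgebra K a 0 :=
      (Polynomial.aeval (R := K) QuadraticAlgebra.omega).toRingHom
    have hform : finSuccEquiv F m (formPoly q) =
        Polynomial.C (C (q 0)) * (Polynomial.X ^ 2 + Polynomial.C r) := by
      rw [finSuccEquiv_formPoly, mul_add, ← Polynomial.C_mul, hr]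
    have hmap : (Polynomial.X ^ 2 + Polynomial.C r).map (algebraMap R K) =
        Polynomial.X ^ 2 - Polynomial.C a := by
      simp [a]
    refine ⟨ev.comp ψ, le_antisymm (fun p hp => ?_) ?_, fun c => ?_⟩
    · have h1 := dvd_of_aeval_omega_eq_zero (a := a) (p := ψ p) hp
      rw [← hmap] at h1
      have h3 : Polynomial.X ^ 2 + Polynomial.C r ∣ finSuccEquiv F m p :=
        (Polynomial.map_dvd_map (algebraMap R K) (IsFractionRing.injective R K)
          (Polynomial.monic_X_pow_add_C r two_ne_zero)).mp h1
      have hu : IsUnit (Polynomial.C (C (q 0)) : Polynomial R) :=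
        ((isUnit_iff_ne_zero.mpr hq0).map (C : F →+* R)).map Polynomial.C
      rw [Ideal.mem_span_singleton, ← map_dvd_iff (finSuccEquiv F m), hform]
      exact (hu.mul_left_dvd).mpr h3
    · rw [Ideal.span_singleton_le_iff_mem, RingHom.mem_ker]
      have h1 : ψ (formPoly q) = Polynomial.C (φ (q 0)) *
          (Polynomial.X ^ 2 - Polynomial.C a) := by
        rw [← hmap]
        change (finSuccEquiv F m (formPoly q)).map _ = _
        rw [hform, Polynomial.map_mul, Polynomial.map_C, hφ]
      rw [RingHom.comp_apply, h1]
      simp only [ev, AlgHom.toRingHom_eq_coe, RingHom.coe_coe, map_mul, map_sub, map_pow,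
        Polynomial.aeval_X, Polynomial.aeval_C]
      rw [pow_two, QuadraticAlgebra.omega_mul_omega_eq_mk, QuadraticAlgebra.algebraMap_eq a,
        sub_self, mul_zero]
    · have h1 : ψ (C c) = Polynomial.C (φ c) := by
        simp [ψ, finSuccEquiv_apply, hφ]
      rw [RingHom.comp_apply, h1]
      exact Polynomial.aeval_C _ _

theorem exists_funField_hom {q : Fin (m + 1) → F} (hq : Aniso q) (hm : 0 < m) :
    IsDomain (CoordRing q) ∧ ∃ a : FractionRing (MvPolynomial (Fin m) F),
      a ≠ 0 ∧ algebraMap F _ (q 0) * a = - algebraMap _ _ (tailPoly q) ∧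
      ∃ Θ : FunField q →+* QuadraticAlgebra _ a 0,
        ∀ c, Θ (algebraMap F _ c) =
          algebraMap (FractionRing (MvPolynomial (Fin m) F)) _ (algebraMap F _ c) := by
  obtain ⟨a, ha, hsq, Θ, hker, hΘ⟩ := exists_quadratic_hom hq hm
  have : Fact (∀ r : FractionRing (MvPolynomial (Fin m) F), r ^ 2 ≠ a + 0 * r) :=
    ⟨fun r => by simpa using hsq r⟩
  have hprime : (Ideal.span {formPoly q}).IsPrime := hker ▸ RingHom.ker_isPrime Θ
  have hdom : IsDomain (CoordRing q) := (Ideal.Quotient.isDomain_iff_prime _).mpr hprime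
  let Λ : CoordRing q →+* QuadraticAlgebra _ a 0 := Ideal.Quotient.lift _ Θ fun p hp => by
    rwa [← hker, RingHom.mem_ker] at hp
  have hΛ : Function.Injective Λ := RingHom.lift_injective_of_ker_le_ideal _ _ hker.le
  refine ⟨hdom, a, fun h0 => hsq 0 (by rw [h0, zero_pow two_ne_zero]), ha,
    IsFractionRing.lift hΛ, fun c => ?_⟩
  rw [IsScalarTower.algebraMap_apply F (CoordRing q) (FunField q), IsFractionRing.lift_algebraMap,
    ← hΘ]
  rfl

/-- The generic point of the quadric is an isotropic vector over the function field. -/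
theorem not_aniso_funField {q : Fin (m + 1) → F} (hq : Aniso q)
    [IsDomain (CoordRing q)] : ¬ Aniso fun i => algebraMap F (FunField q) (q i) := by
  intro h
  let x : Fin (m + 1) → CoordRing q := fun i => Ideal.Quotient.mk _ (X i)
  have hx : qf (fun i => algebraMap F (CoordRing q) (q i)) x = 0 := by
    have h1 : Ideal.Quotient.mk (Ideal.span {formPoly q}) (formPoly q) = 0 :=
      Ideal.Quotient.eq_zero_iff_mem.mpr (Ideal.mem_span_singleton_self _)
    have h3 : formPoly q = qf (fun i => C (q i)) X := rfl
    rw [h3, map_qf] at h1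
    exact h1
  have h1 := congrArg (algebraMap (CoordRing q) (FunField q)) hx
  rw [map_qf, map_zero] at h1
  have h3 := congrFun (h _ h1) 0
  have h4 : x 0 = 0 := IsFractionRing.injective (CoordRing q) (FunField q) (h3.trans (map_zero _).symm)
  rw [Ideal.Quotient.eq_zero_iff_mem, Ideal.mem_span_singleton,
    ← map_dvd_iff (finSuccEquiv F m), finSuccEquiv_formPoly, finSuccEquiv_X_zero] at h4
  have h5 := Polynomial.natDegree_le_of_dvd h4 Polynomial.X_ne_zero
  rw [Polynomial.natDegree_X, Polynomial.natDegree_add_C, Polynomial.natDegree_C_mul_X_pow] at h5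
  · omega
  · simpa using hq.ne_zero 0

end FunctionField

end QF

namespace QF

section Hyperbolic

theorem IsHyperbolic.exists_family {L : Type*} [Field L] (h2 : (2 : L) ≠ 0) {n : ℕ} {d : Fin n → L}
    (h : IsHyperbolic d) : ∃ k, k + k = n ∧ ∃ w w' : Fin k → Fin n → L,
      (∀ i j, bf d (w i) (w j) = 0) ∧ ∀ i j, bf d (w i) (w' j) = if i = j then 1 else 0 := by
  obtain ⟨k, φ, hφ⟩ := h
  have hk : k + k = n := by simpa using φ.finrank_eq.symm
  let U : Fin (k + k) → Fin n → L := fun i => φ.symm (Pi.single i 1)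
  have hU : ∀ i j, bf d (U i) (U j) = if i = j then hypform k i else 0 := fun i j => by
    have h1 := bf_map_of_qf_map h2 (C := φ.symm.toLinearMap) (d := hypform k) (e := d) (p := 1)
      (fun y => by
        rw [one_mul]
        have := hφ (φ.symm y)
        rw [φ.apply_symm_apply] at this
        exact this.symm) (Pi.single i 1) (Pi.single j 1)
    rw [one_mul, bf_single_single] at h1
    exact h1
  have hne : ∀ i j : Fin k, Fin.castAdd k i ≠ Fin.natAdd k j := fun i j h => by
    have := congrArg Fin.val h
    simp at this
    omega
  refine ⟨k, hk, fun i => U (Fin.castAdd k i) + U (Fin.natAdd k i), fun i => U (Fin.castAdd k i),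
    fun i j => ?_, fun i j => ?_⟩
  · simp only [map_add, LinearMap.add_apply, hU, hypform, Fin.append_left, Fin.append_right, hne,
      (hne _ _).symm, Fin.castAdd_inj, Fin.natAdd_inj, if_false]
    split_ifs <;> simp
  · simp only [map_add, LinearMap.add_apply, hU, hypform, Fin.append_left, (hne _ _).symm,
      Fin.castAdd_inj, if_false, add_zero]

/-- If an anisotropic form becomes hyperbolic over the quadratic extension generated by `√a`, then
it admits a skew-adjoint similitude with factor `-a⁻¹`. -/
theorem exists_skew_similitude {K : Type*} [Field K] (h2 : (2 : K) ≠ 0) {a : K} (ha : a ≠ 0) {k n : ℕ}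
    (hk : k + k = n) {d : Fin n → K} (hd : Aniso d)
    {w w' : Fin k → Fin n → QuadraticAlgebra K a 0}
    (hw : ∀ i j, bf (fun i => algebraMap K _ (d i)) (w i) (w j) = 0)
    (hw' : ∀ i j, bf (fun i => algebraMap K _ (d i)) (w i) (w' j) = if i = j then 1 else 0) :
    ∃ T : (Fin n → K) →ₗ[K] (Fin n → K), ∀ x, qf d x + a * qf d (T x) = 0 ∧ bf d x (T x) = 0 := by
  let D : Fin n → QuadraticAlgebra K a 0 := fun i => algebraMap K _ (d i)
  let V : (Fin k → QuadraticAlgebra K a 0) →ₗ[K] (Fin n → QuadraticAlgebra K a 0) :=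
    (Fintype.linearCombination (QuadraticAlgebra K a 0) w).restrictScalars K
  have hV : ∀ y, V y = ∑ i, y i • w i := fun y => rfl
  have hVq : ∀ y, bf D (V y) (V y) = 0 := fun y => by
    simp [hV, D, hw]
  have hVw : ∀ y j, bf D (V y) (w' j) = y j := fun y j => by
    simp [hV, D, hw']
  let re : (Fin n → QuadraticAlgebra K a 0) →ₗ[K] (Fin n → K) :=
    (QuadraticAlgebra.reₗ (a := a) (b := 0)).compLeft (Fin n)
  let im : (Fin n → QuadraticAlgebra K a 0) →ₗ[K] (Fin n → K) :=
    (QuadraticAlgebra.imₗ (a := a) (b := 0)).compLeft (Fin n)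
  have hre : ∀ v i, re v i = (v i).re := fun v i => rfl
  have him : ∀ v i, im v i = (v i).im := fun v i => rfl
  have hbre : ∀ v, (bf D v v).re = qf d (re v) + a * qf d (im v) := fun v => by
    have h1 := map_sum (QuadraticAlgebra.reₗ (a := a) (b := 0)) (fun i => D i * v i * v i)
      Finset.univ
    refine h1.trans ?_
    rw [qf, qf, Finset.mul_sum, ← Finset.sum_add_distrib]
    refine Finset.sum_congr rfl fun i _ => ?_
    rw [hre, him]
    simp [D]
    ring
  have hbim : ∀ v, (bf D v v).im = 2 * bf d (re v) (im v) := fun v => by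
    have h1 := map_sum (QuadraticAlgebra.imₗ (a := a) (b := 0)) (fun i => D i * v i * v i)
      Finset.univ
    refine h1.trans ?_
    rw [bf_apply, Finset.mul_sum]
    refine Finset.sum_congr rfl fun i _ => ?_
    rw [hre, him]
    simp [D]
    ring
  have hq1 : ∀ y, qf d (re (V y)) + a * qf d (im (V y)) = 0 := fun y => by
    rw [← hbre, hVq, QuadraticAlgebra.re_zero]
  have hq3 : ∀ y, bf d (re (V y)) (im (V y)) = 0 := fun y => by
    have h1 := hbim (V y)
    rw [hVq, QuadraticAlgebra.im_zero] at h1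
    exact (mul_eq_zero.mp h1.symm).resolve_left h2
  have hinj : Function.Injective (re ∘ₗ V) := by
    rw [← LinearMap.ker_eq_bot, LinearMap.ker_eq_bot']
    intro y hy
    rw [LinearMap.comp_apply] at hy
    have h1 := hq1 y
    rw [hy, qf_zero, zero_add] at h1
    have h3 := hd _ ((mul_eq_zero.mp h1).resolve_left ha)
    have h4 : V y = 0 := funext fun i =>
      QuadraticAlgebra.ext (congrFun hy i) (congrFun h3 i)
    funext j
    refine (hVw y j).symm.trans ?_
    rw [h4]
    simp
  let E := LinearMap.linearEquivOfInjective (re ∘ₗ V) hinj (by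
    rw [Module.finrank_pi_fintype]
    simp [QuadraticAlgebra.finrank_eq_two]
    omega)
  refine ⟨im ∘ₗ V ∘ₗ E.symm.toLinearMap, fun x => ?_⟩
  obtain ⟨y, rfl⟩ := E.surjective x
  simp only [LinearMap.comp_apply, LinearEquiv.coe_coe, LinearEquiv.symm_apply_apply]
  exact ⟨hq1 y, hq3 y⟩

end Hyperbolic

end QF

namespace QF

section Main

open MvPolynomial

universe u

variable {F : Type u} [Field F] {m : ℕ}

/-- A skew-adjoint similitude with denominators cleared. -/
theorem exists_skew_vectors (h2 : (2 : F) ≠ 0) {q : Fin (m + 1) → F} (hq : Aniso q) (hm : 0 < m)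
    (h : IsHyperbolic (bc (algebraMap F (FunField q)) q)) :
    ∃ g : MvPolynomial (Fin m) F, g ≠ 0 ∧
      ∃ M : Fin (m + 1) → Fin (m + 1) → MvPolynomial (Fin m) F,
        (∀ j k, tailPoly q * bf (fun i => C (q i)) (M j) (M k) =
          C (q 0) * g ^ 2 * if j = k then C (q j) else 0) ∧
        ∀ j k, bf (fun i => C (q i)) (Pi.single j 1) (M k) +
          bf (fun i => C (q i)) (Pi.single k 1) (M j) = 0 := by
  obtain ⟨hdom, a, ha0, ha, Θ, hΘ⟩ := exists_funField_hom hq hm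
  let R := MvPolynomial (Fin m) F
  let K := FractionRing R
  let φ : F →+* K := algebraMap F K
  have hφ : ∀ a, algebraMap R K (C a) = φ a := fun a => rfl
  have h2K : (2 : K) ≠ 0 := by
    have := (map_ne_zero φ).mpr h2
    rwa [map_ofNat] at this
  have h2L : (2 : FunField q) ≠ 0 := by
    have := (map_ne_zero (algebraMap F (FunField q))).mpr h2
    rwa [map_ofNat] at this
  have hqK : Aniso fun i => φ (q i) := (hq.mvPolynomial (Fin m)).fractionRing K
  obtain ⟨k, hk, w, w', hw, hw'⟩ := h.exists_family h2L
  have hΘb : ∀ v v' : Fin (m + 1) → FunField q,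
      bf (fun i => algebraMap K (QuadraticAlgebra K a 0) (φ (q i))) (fun i => Θ (v i))
        (fun i => Θ (v' i)) = Θ (bf (bc (algebraMap F (FunField q)) q) v v') := fun v v' => by
    rw [map_bf]
    simp only [bc, hΘ]
    rfl
  obtain ⟨T, hT⟩ := exists_skew_similitude h2K ha0 hk hqK
    (w := fun j i => Θ (w j i)) (w' := fun j i => Θ (w' j i))
    (fun i j => by rw [hΘb, hw, map_zero])
    (fun i j => by rw [hΘb, hw']; split_ifs <;> simp)
  set d : Fin (m + 1) → K := fun i => φ (q i) with hd
  set ρ : K := algebraMap R K (tailPoly q) with hρ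
  have hskew : ∀ x y, bf d x (T y) + bf d y (T x) = 0 := fun x y => by
    have h1 := (hT (x + y)).2
    simp only [map_add, LinearMap.add_apply, (hT _).2] at h1
    linear_combination h1
  have hsim : ∀ x y, ρ * bf d (T x) (T y) = φ (q 0) * bf d x y := fun x y => by
    have h1 : ∀ x, ρ * qf d (T x) = φ (q 0) * qf d x := fun x => by
      linear_combination -φ (q 0) * (hT x).1 + qf d (T x) * ha
    have h3 := h1 (x + y)
    rw [map_add, qf_add, qf_add] at h3
    apply mul_left_cancel₀ h2K
    linear_combination h3 - h1 x - h1 y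
  obtain ⟨g, hg, N, hN⟩ := exists_common_denominator (R := R)
    fun p : Fin (m + 1) × Fin (m + 1) => T (Pi.single p.1 1) p.2
  have hNT : ∀ j, (fun i => algebraMap R K (N (j, i))) = algebraMap R K g • T (Pi.single j 1) :=
    fun j => funext fun i => hN (j, i)
  have hs : ∀ j : Fin (m + 1), (fun i => algebraMap R K ((Pi.single j 1 : Fin (m + 1) → R) i)) =
      Pi.single j 1 := fun j => funext fun i => by
    rw [Pi.single_apply, Pi.single_apply]
    split_ifs <;> simp
  refine ⟨g, hg, fun j i => N (j, i), fun j k => ?_, fun j k => ?_⟩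
  · apply IsFractionRing.injective R K
    rw [map_mul, map_bf, hNT, hNT]
    simp only [map_smul, LinearMap.smul_apply, smul_eq_mul, map_mul, map_pow, hφ]
    have h1 := hsim (Pi.single j 1) (Pi.single k 1)
    rw [bf_single_single] at h1
    have h3 : algebraMap R K (if j = k then C (q j) else 0) = if j = k then d j else 0 := by
      split_ifs <;> simp [hφ, hd]
    rw [h3]
    linear_combination algebraMap R K g ^ 2 * h1
  · apply IsFractionRing.injective R K
    rw [map_add, map_bf, map_bf, hNT, hNT, hs, hs, map_zero]
    simp only [map_smul, smul_eq_mul, hφ]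
    linear_combination algebraMap R K g * hskew (Pi.single j 1) (Pi.single k 1)

theorem rename_succ_tailPoly (q : Fin (m + 1) → F) :
    C (q 0) * X 0 ^ 2 + rename Fin.succ (tailPoly q) = formPoly q := by
  simp [tailPoly, formPoly, qf, Fin.sum_univ_succ]

/-- An anisotropic form which is hyperbolic over its function field is multiplicative over the
polynomial ring, up to squares. -/
theorem exists_multiplicative_vectors (h2 : (2 : F) ≠ 0) {q : Fin (m + 1) → F} (hq : Aniso q)
    (hm : 0 < m) (h : IsHyperbolic (bc (algebraMap F (FunField q)) q)) :
    ∃ g : MvPolynomial (Fin (m + 1)) F, g ≠ 0 ∧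
      ∃ P : Fin (m + 1) → Fin (m + 1) → MvPolynomial (Fin (m + 1)) F,
        ∀ j k, bf (fun i => C (q i)) (P j) (P k) =
          g ^ 2 * (C (q 0) * formPoly q * if j = k then C (q j) else 0) := by
  obtain ⟨g, hg, M, hM, hskew⟩ := exists_skew_vectors h2 hq hm h
  let S := MvPolynomial (Fin (m + 1)) F
  let ε : MvPolynomial (Fin m) F →+* S := (rename Fin.succ).toRingHom
  have hε : ∀ c, ε (C c) = C c := fun c => rename_C _ c
  let D : Fin (m + 1) → S := fun i => C (q i)
  let M' : Fin (m + 1) → Fin (m + 1) → S := fun j i => ε (M j i)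
  have hMb : ∀ v v', ε (bf (fun i => C (q i)) v v') = bf D (fun i => ε (v i)) fun i => ε (v' i) :=
    fun v v' => by
      rw [map_bf]
      simp only [hε]
      rfl
  have hs : ∀ j : Fin (m + 1), (fun i => ε ((Pi.single j 1 : Fin (m + 1) → _) i)) =
      Pi.single j 1 := fun j => funext fun i => by
    rw [Pi.single_apply, Pi.single_apply]
    split_ifs <;> simp
  have hM' : ∀ j k, ε (tailPoly q) * bf D (M' j) (M' k) =
      C (q 0) * ε g ^ 2 * if j = k then D j else 0 := fun j k => by
    have h1 := congrArg ε (hM j k)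
    rw [map_mul, hMb, map_mul, map_mul, map_pow, hε] at h1
    refine h1.trans ?_
    split_ifs <;> simp [hε, D]
  have hskew' : ∀ j k, bf D (Pi.single j 1) (M' k) + bf D (Pi.single k 1) (M' j) = 0 :=
    fun j k => by
      have h1 := congrArg ε (hskew j k)
      rwa [map_add, hMb, hMb, hs, hs, map_zero] at h1
  refine ⟨ε g, fun h0 => hg (rename_injective _ (Fin.succ_injective m) (h0.trans (map_zero ε).symm)),
    fun j => (ε g * C (q 0) * X 0) • Pi.single j 1 + ε (tailPoly q) • M' j, fun j k => ?_⟩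
  change bf D _ _ = _ * (_ * if j = k then D j else 0)
  have hf : C (q 0) * X 0 ^ 2 + ε (tailPoly q) = formPoly q := rename_succ_tailPoly q
  simp only [map_add, LinearMap.add_apply, map_smul, LinearMap.smul_apply, smul_eq_mul,
    bf_single_single, bf_comm D (M' j) (Pi.single k 1)]
  rw [← hf]
  linear_combination ε g * C (q 0) * X 0 * ε (tailPoly q) * hskew' j k +
    ε (tailPoly q) * hM' j k

theorem stronglyRound_of_isHyperbolic (h2 : (2 : F) ≠ 0) {q : Fin (m + 1) → F} (hq : Aniso q)
    (hm : 0 < m) (h : IsHyperbolic (bc (algebraMap F (FunField q)) q)) :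
    StronglyRound fun i => q 0 * q i := by
  intro K _ _ hK x
  obtain ⟨g, hg, P, hP⟩ := exists_multiplicative_vectors h2 hq hm h
  let φ := algebraMap F K
  let d : Fin (m + 1) → K := fun i => φ (q i)
  have hscale : ∀ v, qf (fun i => φ (q 0 * q i)) v = φ (q 0) * qf d v := fun v => by
    simp only [qf, Finset.mul_sum, map_mul, mul_assoc, d]
  have hdK : Aniso d := fun v hv => hK v (by rw [hscale, hv, mul_zero])
  obtain ⟨A, hA, -⟩ := exists_specialization hdK hg P _ hP x
  have hfx : aeval x (formPoly q) = qf d x := by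
    simp [formPoly, qf, d, φ]
  refine ⟨Fintype.linearCombination K A, fun y => ?_⟩
  rw [hscale, hscale, hscale, Fintype.linearCombination_apply,
    qf_sum_of_orthogonal d (fun j => φ (q 0) * qf d x * d j) A fun i j => by
      rw [hA, map_mul, map_mul, algHom_C, hfx]
      split_ifs <;> simp [d, φ]]
  generalize qf d x = s
  simp only [qf, Finset.mul_sum]
  exact Finset.sum_congr rfl fun i _ => by ring

theorem exists_pfister_of_isHyperbolic (h2 : (2 : F) ≠ 0) {q : Fin (m + 1) → F} (hq : Aniso q)
    (hm : 0 < m) (h : IsHyperbolic (bc (algebraMap F (FunField q)) q)) :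
    ∃ a : F, a ≠ 0 ∧ ∃ (mπ : ℕ) (π : Fin mπ → F), IsPfister π ∧ Isometric q (smulQF a π) := by
  have hq0 := hq.ne_zero 0
  have hscale : ∀ v, qf (fun i => q 0 * q i) v = q 0 * qf q v := fun v => by
    simp only [qf, Finset.mul_sum, mul_assoc]
  have hd : Aniso fun i => q 0 * q i := fun v hv =>
    hq v ((mul_eq_zero.mp ((hscale v).symm.trans hv)).resolve_left hq0)
  obtain ⟨k, a, ha, φ, hφ⟩ := (stronglyRound_of_isHyperbolic h2 hq hm h).exists_pfister h2 hd
    (x := Pi.single 0 (q 0)⁻¹) (by rw [qf_single]; field_simp)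
  refine ⟨(q 0)⁻¹, inv_ne_zero hq0, 2 ^ k, pfisterOf a,
    ⟨k, a, ha, LinearEquiv.refl _ _, fun v => rfl⟩, φ, fun v => ?_⟩
  have h1 : qf (pfisterOf a) (φ v) = q 0 * qf q v := (hφ v).trans (hscale v)
  have h3 : qf (smulQF (q 0)⁻¹ (pfisterOf a)) (φ v) = (q 0)⁻¹ * qf (pfisterOf a) (φ v) := by
    simp only [qf, smulQF, Finset.mul_sum, mul_assoc]
  change qf (smulQF (q 0)⁻¹ (pfisterOf a)) (φ v) = qf q v
  rw [h3, h1, inv_mul_cancel_left₀ hq0]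

/-- Isometries of forms with nonzero coefficients extend along field extensions. -/
theorem Isometric.baseChange {L : Type*} [Field L] (h2 : (2 : F) ≠ 0) (σ : F →+* L) {k n : ℕ}
    {d : Fin k → F} (hd : ∀ i, d i ≠ 0) {e : Fin n → F} (h : Isometric d e) :
    Isometric (fun i => σ (d i)) fun i => σ (e i) := by
  obtain ⟨φ, hφ⟩ := h
  let u : Fin k → Fin n → L := fun j i => σ (φ (Pi.single j 1) i)
  have hu : ∀ i j, bf (fun i => σ (e i)) (u i) (u j) = if i = j then σ (d i) else 0 :=
    fun i j => by
      have h1 := bf_map_of_qf_map h2 (C := φ.toLinearMap) (d := d) (e := e) (p := 1)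
        (fun y => by rw [one_mul]; exact hφ y) (Pi.single i 1) (Pi.single j 1)
      rw [one_mul, bf_single_single] at h1
      refine (map_bf σ e _ _).symm.trans ((congrArg σ h1).trans ?_)
      split_ifs <;> simp
  have hkn : k = n := by simpa using φ.finrank_eq
  refine ⟨LinearMap.linearEquivOfInjective _
    (linearCombination_injective (fun i => (map_ne_zero σ).mpr (hd i)) hu) (by simp [hkn]),
    fun v => ?_⟩
  rw [LinearMap.linearEquivOfInjective_apply, Fintype.linearCombination_apply]
  exact qf_sum_of_orthogonal _ _ u hu v

theorem Isometric.trans {R : Type*} [CommRing R] {k l n : ℕ} {c : Fin k → R} {d : Fin l → R}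
    {e : Fin n → R} (h : Isometric c d) (h' : Isometric d e) : Isometric c e := by
  obtain ⟨φ, hφ⟩ := h
  obtain ⟨ψ, hψ⟩ := h'
  exact ⟨φ.trans ψ, fun v => (hψ _).trans (hφ v)⟩

theorem Isometric.smulQF {R : Type*} [CommRing R] {k l : ℕ} {c : Fin k → R} {d : Fin l → R}
    (h : Isometric c d) (a : R) : Isometric (smulQF a c) (smulQF a d) := by
  obtain ⟨φ, hφ⟩ := h
  refine ⟨φ, fun v => ?_⟩
  have h1 : ∀ {n : ℕ} (e : Fin n → R) v, evalQF (QF.smulQF a e) v = a * evalQF e v := fun e v => by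
    simp only [evalQF, QF.smulQF, Finset.mul_sum, mul_assoc]
  rw [h1, h1, hφ]

theorem isHyperbolic_of_exists_pfister (h2 : (2 : F) ≠ 0) {q : Fin (m + 1) → F} (hq : Aniso q)
    (hm : 0 < m)
    (h : ∃ a : F, a ≠ 0 ∧ ∃ (mπ : ℕ) (π : Fin mπ → F), IsPfister π ∧ Isometric q (smulQF a π)) :
    IsHyperbolic (bc (algebraMap F (FunField q)) q) := by
  obtain ⟨a, ha, mπ, π, ⟨k, b, hb, hπ⟩, hqπ⟩ := h
  obtain ⟨hdom, -⟩ := exists_funField_hom hq hm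
  let L := FunField q
  let σ : F →+* L := algebraMap F L
  have h2L : (2 : L) ≠ 0 := by
    have := (map_ne_zero σ).mpr h2
    rwa [map_ofNat] at this
  obtain ⟨φ, hφ⟩ := (hqπ.trans (hπ.smulQF a)).baseChange h2 σ hq.ne_zero
  let E := φ.trans (LinearEquiv.funCongrLeft L L (finFunctionFinEquiv (m := 2) (n := k)))
  have hE : qf (bc σ q) = fun v => σ a * qf (pf fun i => σ (b i)) (E v) := funext fun v => by
    refine (hφ v).symm.trans ?_
    have h1 : ∀ w, qf (fun i => σ (smulQF a (pfisterOf b) i)) w =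
        σ a * qf (pfisterOf fun i => σ (b i)) w := fun w => by
      simp only [qf, smulQF, Finset.mul_sum, map_mul, mul_assoc, pfisterOf_apply, map_pf]
    refine (h1 (φ v)).trans ?_
    rw [qf_pfisterOf]
    rfl
  have hiso : ¬ Aniso (pf fun i => σ (b i)) := fun h => by
    refine not_aniso_funField hq fun v hv => E.map_eq_zero_iff.mp (h _ ?_)
    have h1 := (congrFun hE v).symm.trans hv
    exact (mul_eq_zero.mp h1).resolve_left ((map_ne_zero σ).mpr ha)
  refine Hyp.isHyperbolic h2L ?_
  rw [hE]
  exact ((hyp_pf_of_isotropic h2L (fun i => (map_ne_zero σ).mpr (hb i)) hiso).comp E).smul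
    ((map_ne_zero σ).mpr ha)

end Main

end QF


open QF in
/-- Wadsworth/Knebusch: an anisotropic form `q` over `F` (char `F ≠ 2`) of dimension at least two
is a scalar multiple of a Pfister form if and only if `q` is hyperbolic over its own function
field `F(q)`. -/
theorem stmt_10 {F : Type*} [Field F] (h2 : (2 : F) ≠ 0)
    {nq : ℕ} (q : Fin nq → F) (hq : Nondeg q) (hq2 : 2 ≤ nq) (hqan : Anisotropic q) :
    (∃ a : F, a ≠ 0 ∧ ∃ (mπ : ℕ) (π : Fin mπ → F), IsPfister π ∧ Isometric q (smulQF a π))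
    ↔ IsHyperbolic (bc (algebraMap F (FunField q)) q) := by
  obtain ⟨m, rfl⟩ := Nat.exists_eq_add_of_le' (one_le_two.trans hq2)
  have hm : 0 < m := by omega
  have hd : Aniso q := fun v hv => by
    by_contra h0
    exact hqan ⟨v, h0, hv⟩
  exact ⟨isHyperbolic_of_exists_pfister h2 hd hm, exists_pfister_of_isHyperbolic h2 hd hm⟩
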